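/- A commutative semigroup variety V is a neutral element of the lattice Com if and only if either V = COM or V = M ∨ N, where M is one of the varieties T or SL and the variety N satisfies the identity x²y = 0. -/

import Mathlib

open FirstOrder

/-! ### Words, identities, and commutative semigroup varieties -/

/-- Semigroup words over the countable alphabet `ℕ`. -/
abbrev SGWord : Type := FreeSemigroup ℕ

/-- A semigroup identity `u = v` is a pair of words. -/
abbrev SGId : Type := SGWord × SGWord

/-- The one-letter word consisting of the letter `n`. -/
def ltr (n : ℕ) : SGWord := FreeSemigroup.of n

/-- `wpow w n` is the word `w^n` (for `n ≥ 1`; by convention `wpow w 0 = w`). -/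
def wpow (w : SGWord) : ℕ → SGWord
  | 0 => w
  | 1 => w
  | n + 2 => wpow w (n + 1) * w

/-- The letter `n` occurs in the word `w`. -/
def OccursIn (n : ℕ) (w : SGWord) : Prop := n = w.head ∨ n ∈ w.tail

/-- A semigroup `S` satisfies the identity `i.1 = i.2` if all evaluations of the two
words in `S` coincide. -/
def SGSatisfies (S : Type) [Semigroup S] (i : SGId) : Prop :=
  ∀ f : ℕ → S, FreeSemigroup.lift f i.1 = FreeSemigroup.lift f i.2

/-- A bundled (nonempty) commutative semigroup. -/
structure ComSG where
  carrier : Type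
  [str : CommSemigroup carrier]
  [instNonempty : Nonempty carrier]

attribute [instance] ComSG.str ComSG.instNonempty

/-- The class of commutative semigroups satisfying every identity in `E`. -/
def modelsOf (E : Set SGId) : Set ComSG := {S | ∀ i ∈ E, SGSatisfies S.carrier i}

/-- The set of identities holding in every member of the class `K`. -/
def theoryOfClass (K : Set ComSG) : Set SGId := {i | ∀ S ∈ K, SGSatisfies S.carrier i}

theorem subset_theoryOfClass_modelsOf (E : Set SGId) : E ⊆ theoryOfClass (modelsOf E) :=
  fun i hi S hS => hS i hi

theorem theoryOfClass_antitone {K K' : Set ComSG} (h : K ⊆ K') :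
    theoryOfClass K' ⊆ theoryOfClass K := fun _ hi S hS => hi S (h hS)

theorem modelsOf_antitone {E E' : Set SGId} (h : E ⊆ E') : modelsOf E' ⊆ modelsOf E :=
  fun _ hS i hi => hS i (h hi)

/-- A variety of commutative semigroups, identified with its (equationally closed)
equational theory.  Varieties are ordered by inclusion of the corresponding classes
of semigroups, i.e. by *reverse* inclusion of theories. -/
structure ComVariety where
  theory : Set SGId
  closed : theoryOfClass (modelsOf theory) = theory

theorem ComVariety.ext' {V W : ComVariety} (h : V.theory = W.theory) : V = W := by
  cases V; cases W; cases h; rfl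

instance : PartialOrder ComVariety where
  le V W := W.theory ⊆ V.theory
  le_refl V := subset_rfl
  le_trans U V W h1 h2 := fun i hi => h1 (h2 hi)
  le_antisymm V W h1 h2 := ComVariety.ext' (subset_antisymm h2 h1)

instance : SupSet ComVariety where
  sSup s :=
    { theory := ⋂ V ∈ s, V.theory
      closed := by
        apply subset_antisymm
        · intro i hi
          refine Set.mem_iInter₂.2 fun V hV => ?_
          have h1 : (⋂ V ∈ s, ComVariety.theory V) ⊆ V.theory := Set.biInter_subset_of_mem hV
          have h2 := theoryOfClass_antitone (modelsOf_antitone h1)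
          rw [V.closed] at h2
          exact h2 hi
        · exact subset_theoryOfClass_modelsOf _ }

/-- The lattice **Com** of all commutative semigroup varieties. -/
instance : CompleteLattice ComVariety :=
  completeLatticeOfSup ComVariety fun s => by
    constructor
    · intro V hV i hi
      exact Set.mem_iInter₂.1 hi V hV
    · intro W hW i hi
      exact Set.mem_iInter₂.2 fun V hV => hW hV hi

/-- The variety of commutative semigroups given by the identity system `E`. -/
def comVar (E : Set SGId) : ComVariety where
  theory := theoryOfClass (modelsOf E)
  closed := by
    apply subset_antisymm
    · exact theoryOfClass_antitone fun S hS i hi => hi S hS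
    · exact subset_theoryOfClass_modelsOf _

/-! ### The first-order language of lattices and definability -/

/-- The first-order language of lattices: two binary function symbols (`true` for the
join `∨` and `false` for the meet `∧`) and nothing else. -/
def latticeLang : Language where
  Functions := fun n => match n with | 2 => Bool | _ => Empty
  Relations := fun _ => Empty

instance latticeLangStructure (L : Type*) [Lattice L] : latticeLang.Structure L where
  funMap {n} f x :=
    match n, f with
    | 2, b => bif b then x 0 ⊔ x 1 else x 0 ⊓ x 1
    | 0, f => f.elim
    | 1, f => f.elim
    | (_ + 3), f => f.elim
  RelMap {n} r _ := r.elim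

/-- A subset `A` of a lattice `L` is definable in `L` if there is a first-order formula
`φ(x)` with one free variable in the language of the lattice operations `∨` and `∧`
such that for every `a ∈ L`, `φ(a)` holds in `L` if and only if `a ∈ A`. -/
def LatDefinable (L : Type*) [Lattice L] (A : Set L) : Prop :=
  ∃ φ : latticeLang.Formula (Fin 1), ∀ a : L, (φ.Realize fun _ => a) ↔ a ∈ A

/-! ### Named varieties -/

/-- The commutativity identity `xy = yx`. -/
def commId : SGId := (ltr 0 * ltr 1, ltr 1 * ltr 0)

/-- The pair of identities abbreviated by the symbolic identity `w = 0`, namely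
`wx = w` and `xw = w`, where `x` is the letter `n` (assumed not to occur in `w`). -/
def zeroId (w : SGWord) (n : ℕ) : Set SGId := {(w * ltr n, w), (ltr n * w, w)}

/-- `A n = var{xⁿy = y, xy = yx}`, the variety of Abelian groups of exponent dividing `n`. -/
def Avar (n : ℕ) : ComVariety := comVar {(wpow (ltr 0) n * ltr 1, ltr 1), commId}

/-- `SL = var{x² = x, xy = yx}`, the variety of semilattices. -/
def SLvar : ComVariety := comVar {(wpow (ltr 0) 2, ltr 0), commId}

/-- `ZM = var{xy = 0}` (within **Com**), the variety of null semigroups. -/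
def ZMvar : ComVariety := comVar ({commId} ∪ zeroId (ltr 0 * ltr 1) 2)

/-- `T = var{x = y}`, the trivial variety. -/
def Tvar : ComVariety := comVar {(ltr 0, ltr 1)}

/-- `COM`, the variety of all commutative semigroups. -/
def COMvar : ComVariety := comVar {commId}

/-- `C m = var{xᵐ = xᵐ⁺¹, xy = yx}` (the variety generated by the cyclic monoid
`⟨a ∣ aᵐ = aᵐ⁺¹⟩`), with the convention `C 0 = T`. -/
def Cvar : ℕ → ComVariety
  | 0 => Tvar
  | m + 1 => comVar {(wpow (ltr 0) (m + 1), wpow (ltr 0) (m + 2)), commId}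

/-- `D m = var{xᵐ = 0, xy = yx}`. -/
def Dvar (m : ℕ) : ComVariety := comVar ({commId} ∪ zeroId (wpow (ltr 0) m) 1)

/-- The word `x₁x₂⋯x_k` (in the letters `0, 1, …, k-1`), for `k ≥ 1`. -/
def chainWord : ℕ → SGWord
  | 0 => ltr 0
  | 1 => ltr 0
  | k + 2 => chainWord (k + 1) * ltr (k + 1)

/-- `N k = var{x² = x₁x₂⋯x_k = 0, xy = yx}`. -/
def Nvar (k : ℕ) : ComVariety :=
  comVar ({commId} ∪ zeroId (wpow (ltr 0) 2) 1 ∪ zeroId (chainWord k) k)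

/-- `N_ω = var{x² = 0, xy = yx}`. -/
def Nomegavar : ComVariety := comVar ({commId} ∪ zeroId (wpow (ltr 0) 2) 1)

/-- `N₃ᶜ = var{xyz = 0, xy = yx}`. -/
def N3cvar : ComVariety := comVar ({commId} ∪ zeroId (ltr 0 * ltr 1 * ltr 2) 3)

/-! ### Semantic notions -/

/-- A semigroup `S` belongs to the variety `V` if it satisfies every identity of `V`. -/
def VMem (S : Type) [Semigroup S] (V : ComVariety) : Prop :=
  ∀ i ∈ V.theory, SGSatisfies S i

/-- `spow a n` is the power `aⁿ` in a semigroup (for `n ≥ 1`; by convention `spow a 0 = a`). -/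
def spow {S : Type} [Semigroup S] (a : S) : ℕ → S
  | 0 => a
  | 1 => a
  | n + 2 => spow a (n + 1) * a

/-- A semigroup is a group. -/
def IsGroupSG (S : Type) [Semigroup S] : Prop :=
  ∃ e : S, (∀ a, e * a = a ∧ a * e = a) ∧ ∀ a, ∃ b, a * b = e ∧ b * a = e

/-- A semigroup is periodic: every element generates a finite cyclic subsemigroup. -/
def IsPeriodicSG (S : Type) [Semigroup S] : Prop :=
  ∀ a : S, ∃ i j : ℕ, 1 ≤ i ∧ i < j ∧ spow a i = spow a j

/-- A semigroup is a nil-semigroup: it has a zero element and every element has a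
power equal to zero. -/
def IsNilSG (S : Type) [Semigroup S] : Prop :=
  ∃ z : S, (∀ a, z * a = z ∧ a * z = z) ∧ ∀ a, ∃ n, 1 ≤ n ∧ spow a n = z

/-- A variety all of whose members are groups. -/
def IsGroupVariety (V : ComVariety) : Prop := ∀ S ∈ modelsOf V.theory, IsGroupSG S.carrier

/-- A variety all of whose members are periodic semigroups. -/
def IsPeriodicVariety (V : ComVariety) : Prop := ∀ S ∈ modelsOf V.theory, IsPeriodicSG S.carrier

/-- A nil-variety: a variety all of whose members are nil-semigroups. -/
def IsNilVariety (V : ComVariety) : Prop := ∀ S ∈ modelsOf V.theory, IsNilSG S.carrier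

/-- A combinatorial variety: all groups in it are trivial. -/
def IsCombinatorial (V : ComVariety) : Prop :=
  ∀ S ∈ modelsOf V.theory, IsGroupSG S.carrier → ∀ a b : S.carrier, a = b

/-- `K` is the variety generated by the semigroup `M` (with explicit semigroup
structure `inst`): the smallest variety containing `M`. -/
def GeneratedBy (M : Type) (inst : Semigroup M) (K : ComVariety) : Prop :=
  IsLeast {W : ComVariety | ∀ i ∈ W.theory, @SGSatisfies M inst i} K

/-- A neutral element of a lattice. -/
def IsNeutralElt {α : Type*} [Lattice α] (x : α) : Prop :=
  ∀ y z, (x ⊔ y) ⊓ (y ⊔ z) ⊓ (z ⊔ x) = (x ⊓ y) ⊔ (y ⊓ z) ⊔ (z ⊓ x)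

/-- A chain variety: a variety whose lattice of subvarieties is a chain. -/
def IsChainVariety (V : ComVariety) : Prop :=
  ∀ W₁ W₂ : ComVariety, W₁ ≤ V → W₂ ≤ V → W₁ ≤ W₂ ∨ W₂ ≤ W₁

/-- A variety is 0-reduced in **Com** if it is given within `COM` by 0-reduced
identities (identities of the form `w = 0`) only. -/
def IsZeroReduced (V : ComVariety) : Prop :=
  ∃ P : Set (SGWord × ℕ), (∀ p ∈ P, ¬ OccursIn p.2 p.1) ∧
    V = comVar (⋃ p ∈ P, zeroId p.1 p.2)

/-- `ZR V`: the least variety 0-reduced in **Com** that contains `V`. -/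
def ZRv (V : ComVariety) : ComVariety := sInf {W : ComVariety | IsZeroReduced W ∧ V ≤ W}

/-! ### Neutral elements of lattices -/

section Neutral

variable {α : Type*} [Lattice α] {x x' : α}

theorem IsNeutralElt.inf_sup_of_le (h : IsNeutralElt x) {y : α} (hy : y ≤ x) (z : α) :
    x ⊓ (y ⊔ z) = y ⊔ z ⊓ x := by
  have := h y z
  rw [sup_eq_left.2 hy, inf_eq_right.2 hy, inf_assoc, inf_comm (y ⊔ z), ← inf_assoc,
    inf_eq_left.2 (le_sup_right : x ≤ z ⊔ x), sup_eq_left.2 (inf_le_left : y ⊓ z ≤ y)] at this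
  exact this

theorem isNeutralElt_toDual : IsNeutralElt (OrderDual.toDual x) ↔ IsNeutralElt x :=
  ⟨fun h y z => (h (OrderDual.toDual y) (OrderDual.toDual z)).symm, fun h y z => (h y z).symm⟩

theorem IsNeutralElt.inf_sup (h : IsNeutralElt x) (y z : α) :
    x ⊓ (y ⊔ z) = x ⊓ y ⊔ x ⊓ z := by
  have h1 : x ⊓ ((x ⊔ y) ⊓ (y ⊔ z) ⊓ (z ⊔ x)) = x ⊓ (y ⊔ z) := by
    apply le_antisymm
    · exact le_inf inf_le_left (inf_le_right.trans (inf_le_left.trans inf_le_right))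
    · exact le_inf inf_le_left (le_inf (le_inf (inf_le_left.trans le_sup_left) inf_le_right)
        (inf_le_left.trans le_sup_right))
  have h2 : x ⊓ y ⊔ y ⊓ z ⊔ z ⊓ x = (x ⊓ y ⊔ x ⊓ z) ⊔ y ⊓ z := by
    rw [inf_comm z x, sup_right_comm]
  rw [← h1, h y z, h2, h.inf_sup_of_le (sup_le inf_le_left inf_le_left)]
  exact sup_eq_left.2 (le_sup_of_le_left (le_inf inf_le_right (inf_le_left.trans inf_le_left)))

theorem IsNeutralElt.sup_inf (h : IsNeutralElt x) (y z : α) :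
    x ⊔ y ⊓ z = (x ⊔ y) ⊓ (x ⊔ z) :=
  (isNeutralElt_toDual.2 h).inf_sup (OrderDual.toDual y) (OrderDual.toDual z)

theorem IsNeutralElt.cancel (h : IsNeutralElt x) {y z : α} (h1 : x ⊓ y = x ⊓ z)
    (h2 : x ⊔ y = x ⊔ z) : y = z := by
  have h3 : y ⊔ z ≤ y ⊓ z := by
    have h4 : y ⊔ z ≤ (x ⊔ y) ⊓ (y ⊔ z) ⊓ (z ⊔ x) := by
      refine le_inf (le_inf (sup_le le_sup_right (h2 ▸ le_sup_right)) le_rfl) ?_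
      rw [sup_comm z x]
      exact sup_le (h2 ▸ le_sup_right) le_sup_right
    rw [h y z] at h4
    refine h4.trans (sup_le (sup_le ?_ le_rfl) ?_)
    · exact le_inf inf_le_right (h1 ▸ inf_le_right)
    · rw [inf_comm z x]
      exact le_inf (h1 ▸ inf_le_right) inf_le_right
  exact le_antisymm (le_sup_left.trans (h3.trans inf_le_right))
    (le_sup_right.trans (h3.trans inf_le_left))

theorem IsNeutralElt.of_laws (h1 : ∀ y z, x ⊓ (y ⊔ z) = x ⊓ y ⊔ x ⊓ z)
    (h2 : ∀ y z, x ⊔ y ⊓ z = (x ⊔ y) ⊓ (x ⊔ z))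
    (h3 : ∀ y z, x ⊓ y = x ⊓ z → x ⊔ y = x ⊔ z → y = z) : IsNeutralElt x := by
  intro y z
  apply h3
  · have e1 : x ⊓ ((x ⊔ y) ⊓ (y ⊔ z) ⊓ (z ⊔ x)) = x ⊓ (y ⊔ z) := by
      apply le_antisymm
      · exact le_inf inf_le_left (inf_le_right.trans (inf_le_left.trans inf_le_right))
      · exact le_inf inf_le_left (le_inf (le_inf (inf_le_left.trans le_sup_left) inf_le_right)
          (inf_le_left.trans le_sup_right))
    rw [e1, h1]
    apply le_antisymm
    · refine le_inf (sup_le inf_le_left inf_le_left) (sup_le ?_ ?_)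
      · exact le_sup_left.trans le_sup_left
      · rw [inf_comm x z]; exact le_sup_right
    · rw [← h1]
      refine le_inf inf_le_left (inf_le_right.trans (sup_le (sup_le ?_ ?_) ?_))
      · exact inf_le_right.trans le_sup_left
      · exact inf_le_left.trans le_sup_left
      · exact inf_le_left.trans le_sup_right
  · have e1 : x ⊔ (x ⊓ y ⊔ y ⊓ z ⊔ z ⊓ x) = x ⊔ y ⊓ z := by
      apply le_antisymm
      · exact sup_le le_sup_left (sup_le (sup_le (inf_le_left.trans le_sup_left) le_sup_right)
          (inf_le_right.trans le_sup_left))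
      · exact sup_le le_sup_left (le_sup_right.trans le_sup_left |>.trans le_sup_right)
    rw [e1]
    apply le_antisymm
    · rw [h2 y z]
      refine sup_le (le_inf le_sup_left le_sup_left) (le_inf (inf_le_left.trans inf_le_left) ?_)
      rw [sup_comm x z]
      exact inf_le_right
    · exact sup_le_sup_left (le_inf (le_inf (inf_le_left.trans le_sup_right)
        (inf_le_left.trans le_sup_left)) (inf_le_right.trans le_sup_left)) x

theorem IsNeutralElt.sup_inf_of_mem (h : IsNeutralElt x) (t b : α) :
    t ⊔ x ⊓ b = (t ⊔ x) ⊓ (t ⊔ b) := by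
  apply h.cancel
  · rw [h.inf_sup, ← inf_assoc, inf_idem, ← inf_assoc, inf_eq_left.2 (le_sup_right : x ≤ t ⊔ x),
      h.inf_sup]
  · rw [h.sup_inf, sup_left_comm, sup_eq_left.2 (inf_le_left : x ⊓ b ≤ x), sup_left_comm x t x,
      sup_idem]
    exact (inf_eq_left.2 (by
      rw [sup_left_comm]; exact sup_le_sup_left le_sup_left t)).symm

theorem IsNeutralElt.inf (h : IsNeutralElt x) (h' : IsNeutralElt x') :
    IsNeutralElt (x ⊓ x') := by
  have key : ∀ t, x ⊓ x' ⊔ t = (x ⊔ t) ⊓ (x' ⊔ t) := fun t => by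
    rw [sup_comm, h.sup_inf_of_mem, sup_comm t, sup_comm t]
  apply IsNeutralElt.of_laws
  · intro y z
    rw [inf_assoc, h'.inf_sup, h.inf_sup, inf_assoc, inf_assoc]
  · intro y z
    rw [key, key, key, h.sup_inf, h'.sup_inf]
    ac_rfl
  · intro y z h1 h2
    have e1 : x ⊔ y = x ⊔ z := by
      have := congrArg (x ⊔ ·) h2
      simpa [← sup_assoc] using this
    have e2 : x' ⊔ y = x' ⊔ z := by
      have := congrArg (x' ⊔ ·) h2
      simpa [← sup_assoc] using this
    refine h.cancel (h'.cancel ?_ ?_) e1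
    · rw [← inf_assoc, inf_comm x', h1, ← inf_assoc, inf_comm x' x]
    · rw [h'.sup_inf, h'.sup_inf, e2]

end Neutral

/-! ### Fully invariant congruences on commutative words -/

/-- Commutative words over the alphabet `ℕ`, recorded by the multiplicities of their letters
(written additively); the zero vector plays the role of the empty word. -/
abbrev CWord : Type := ℕ →₀ ℕ

/-- The one-letter commutative word. -/
noncomputable abbrev CWord.letter (i : ℕ) : CWord := Finsupp.single i 1

/-- The substitution replacing the letter `i` by the word `θ i`. -/
noncomputable abbrev CWord.subst (θ : ℕ → CWord) : CWord →ₗ[ℕ] CWord :=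
  Finsupp.linearCombination ℕ θ

open CWord

theorem CWord.subst_apply (θ : ℕ → CWord) (u : CWord) (a : ℕ) :
    subst θ u a = ∑ i ∈ u.support, u i * θ i a := by
  simp [subst, Finsupp.linearCombination_apply, Finsupp.sum, Finsupp.finsetSum_apply]

theorem CWord.subst_apply_of_subset (θ : ℕ → CWord) (u : CWord) {s : Finset ℕ}
    (h : u.support ⊆ s) (a : ℕ) : subst θ u a = ∑ i ∈ s, u i * θ i a := by
  rw [subst_apply]
  exact Finset.sum_subset h fun i _ hi => by simp [Finsupp.notMem_support_iff.1 hi]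

theorem CWord.subst_ne_zero {θ : ℕ → CWord} (hθ : ∀ i, θ i ≠ 0) {u : CWord} (hu : u ≠ 0) :
    subst θ u ≠ 0 := by
  obtain ⟨i, hi⟩ := Finsupp.ne_iff.1 hu
  obtain ⟨a, ha⟩ := Finsupp.ne_iff.1 (hθ i)
  intro h
  have h1 := DFunLike.congr_fun h a
  rw [subst_apply, Finsupp.zero_apply, Finset.sum_eq_zero_iff] at h1
  have h2 := h1 i (Finsupp.mem_support_iff.2 hi)
  simp_all

theorem CWord.subst_congr {θ η : ℕ → CWord} {u : CWord} (h : ∀ i, u i ≠ 0 → θ i = η i) :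
    subst θ u = subst η u :=
  Finset.sum_congr rfl fun i hi => by
    simp [h i (Finsupp.mem_support_iff.1 hi)]

theorem CWord.subst_letter (u : CWord) : subst letter u = u := by
  simp [subst, Finsupp.linearCombination_apply, Finsupp.sum_single]

theorem CWord.subst_eq_self {θ : ℕ → CWord} {u : CWord} (h : ∀ i, u i ≠ 0 → θ i = letter i) :
    subst θ u = u := (subst_congr h).trans (subst_letter u)

theorem CWord.degree_eq_sum (u : CWord) : u.degree = ∑ i ∈ u.support, u i := rfl

theorem CWord.subst_const (r : CWord) (u : CWord) :
    subst (fun _ => r) u = u.degree • r := by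
  rw [degree_eq_sum, Finset.sum_smul]
  rfl

theorem CWord.letter_ne_zero (i : ℕ) : letter i ≠ 0 := by simp

theorem CWord.exists_ne_zero {u : CWord} (hu : u ≠ 0) : ∃ i, u i ≠ 0 := by
  simpa using Finsupp.ne_iff.1 hu

theorem CWord.eq_smul_letter_add {u : CWord} {i n : ℕ} (h : n ≤ u i) :
    ∃ q, u = n • letter i + q := by
  refine exists_add_of_le fun j => ?_
  by_cases hj : i = j
  · subst hj; simpa using h
  · simp [hj]

theorem CWord.degree_subst (θ : ℕ → CWord) (u : CWord) :
    (subst θ u).degree = ∑ i ∈ u.support, u i * (θ i).degree := by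
  simp [subst, Finsupp.linearCombination_apply, Finsupp.sum, map_sum]

theorem CWord.degree_pos {u : CWord} (hu : u ≠ 0) : 1 ≤ u.degree :=
  Nat.one_le_iff_ne_zero.2 (mt (Finsupp.degree_eq_zero_iff u).1 hu)

theorem CWord.degree_le_degree_subst {θ : ℕ → CWord} (hθ : ∀ i, θ i ≠ 0) (u : CWord) :
    u.degree ≤ (subst θ u).degree := by
  rw [degree_subst, degree_eq_sum]
  exact Finset.sum_le_sum fun i _ => Nat.le_mul_of_pos_right _ (degree_pos (hθ i))

/-- A fully invariant congruence of the free commutative semigroup over `ℕ`, extended to the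
empty word by making the latter a singleton class. -/
@[ext]
structure FullyInvCongr where
  rel : CWord → CWord → Prop
  refl' : ∀ u, rel u u
  symm' : ∀ {u v}, rel u v → rel v u
  trans' : ∀ {u v w}, rel u v → rel v w → rel u w
  add_right' : ∀ {u v} w, rel u v → rel (u + w) (v + w)
  subst' : ∀ {u v} {θ : ℕ → CWord}, (∀ i, θ i ≠ 0) → rel u v → rel (subst θ u) (subst θ v)
  eq_zero' : ∀ {v}, rel 0 v → v = 0

namespace FullyInvCongr

instance : CoeFun FullyInvCongr fun _ => CWord → CWord → Prop := ⟨rel⟩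

instance : PartialOrder FullyInvCongr where
  le β γ := ∀ u v, β u v → γ u v
  le_refl _ _ _ h := h
  le_trans _ _ _ h h' _ _ h'' := h' _ _ (h _ _ h'')
  le_antisymm β γ h h' := FullyInvCongr.ext (by ext u v; exact ⟨h u v, h' u v⟩)

instance : Lattice FullyInvCongr where
  inf β γ :=
    { rel := fun u v => β u v ∧ γ u v
      refl' := fun u => ⟨β.refl' u, γ.refl' u⟩
      symm' := fun h => ⟨β.symm' h.1, γ.symm' h.2⟩
      trans' := fun h h' => ⟨β.trans' h.1 h'.1, γ.trans' h.2 h'.2⟩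
      add_right' := fun w h => ⟨β.add_right' w h.1, γ.add_right' w h.2⟩
      subst' := fun hθ h => ⟨β.subst' hθ h.1, γ.subst' hθ h.2⟩
      eq_zero' := fun h => β.eq_zero' h.1 }
  inf_le_left _ _ _ _ h := h.1
  inf_le_right _ _ _ _ h := h.2
  le_inf _ _ _ h h' _ _ h'' := ⟨h _ _ h'', h' _ _ h''⟩
  sup β γ :=
    { rel := Relation.ReflTransGen fun u v => β u v ∨ γ u v
      refl' := fun _ => .refl
      symm' := fun h => by
        induction h with
        | refl => exact .refl
        | tail _ h ih => exact .head (h.imp β.symm' γ.symm') ih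
      trans' := .trans
      add_right' := fun w h => h.lift (· + w) fun _ _ => Or.imp (β.add_right' w) (γ.add_right' w)
      subst' := fun {u v θ} hθ h =>
        h.lift (subst θ) fun _ _ => Or.imp (β.subst' hθ) (γ.subst' hθ)
      eq_zero' := fun h => by
        induction h with
        | refl => rfl
        | tail _ h ih => subst ih; exact h.elim β.eq_zero' γ.eq_zero' }
  le_sup_left _ _ _ _ h := .single (.inl h)
  le_sup_right _ _ _ _ h := .single (.inr h)
  sup_le β γ δ h h' u v h'' := by
    induction h'' with
    | refl => exact δ.refl' _
    | tail _ h1 ih => exact δ.trans' ih (h1.elim (h _ _) (h' _ _))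

instance : BoundedOrder FullyInvCongr where
  bot :=
    { rel := Eq
      refl' := fun _ => rfl
      symm' := Eq.symm
      trans' := Eq.trans
      add_right' := by rintro u v w rfl; rfl
      subst' := by rintro u v w - rfl; rfl
      eq_zero' := Eq.symm }
  bot_le β u v h := by
    have h : u = v := h
    exact h ▸ β.refl' u
  top :=
    { rel := fun u v => u = 0 ↔ v = 0
      refl' := fun _ => Iff.rfl
      symm' := Iff.symm
      trans' := Iff.trans
      add_right' := fun w h => by simp [h]
      subst' := fun {u v θ} hθ h => by
        have : ∀ w, subst θ w = 0 ↔ w = 0 := fun w =>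
          ⟨fun h => by_contra fun h' => subst_ne_zero hθ h' h, fun h => by simp [h]⟩
        rw [this, this, h]
      eq_zero' := fun h => h.1 rfl }
  le_top β u v h := ⟨fun hu => by subst hu; exact β.eq_zero' h,
    fun hv => by subst hv; exact β.eq_zero' (β.symm' h)⟩

theorem mono {β γ : FullyInvCongr} (h : β ≤ γ) {u v : CWord} (h' : β u v) : γ u v := h u v h'

theorem sup_iff {β γ : FullyInvCongr} {u v : CWord} :
    (β ⊔ γ) u v ↔ Relation.ReflTransGen (fun u v => β u v ∨ γ u v) u v := Iff.rfl

section Basic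

variable (β : FullyInvCongr) {u v w : CWord}

theorem add_left (w : CWord) (h : β u v) : β (w + u) (w + v) := by
  simpa [add_comm] using β.add_right' w h

theorem add {u' v' : CWord} (h : β u v) (h' : β u' v') : β (u + u') (v + v') :=
  β.trans' (β.add_right' _ h) (β.add_left _ h')

theorem ne_zero (h : β u v) (hne : u ≠ v) : u ≠ 0 := by
  rintro rfl
  exact hne (β.eq_zero' h).symm

/-- Repeated multiplication by an absorbed factor. -/
theorem add_nsmul {t : CWord} (h : β u (u + t)) (n : ℕ) : β u (u + n • t) := by
  induction n with
  | zero => simpa using β.refl' u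
  | succ n ih =>
    have := β.trans' ih (β.add_right' (n • t) h)
    rwa [add_assoc, add_comm t, ← succ_nsmul] at this

/-- A word absorbing each of its letters absorbs all words over these letters. -/
theorem absorb (h : ∀ j, w j ≠ 0 → β w (w + letter j)) {s : CWord}
    (hs : ∀ j, s j ≠ 0 → w j ≠ 0) : β w (w + s) := by
  induction s using Finsupp.induction with
  | zero => simpa using β.refl' w
  | single_add a b f ha hb ih =>
    have ha0 : f a = 0 := Finsupp.notMem_support_iff.1 ha
    have h1 : β w (w + f) := ih fun j hj => hs j (by
      rw [Finsupp.add_apply]; omega)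
    have h2 : β w (w + b • letter a) :=
      β.add_nsmul (h a (hs a (by simp [ha0, hb]))) b
    have h3 := β.trans' h2 (β.add_right' _ h1)
    rw [Finsupp.smul_single_one] at h3
    rwa [add_assoc, add_comm f] at h3

theorem subst_pair {a b c d : ℕ} {p q : CWord}
    (h : β (a • letter 0 + b • letter 1) (c • letter 0 + d • letter 1))
    (hp : p ≠ 0) (hq : q ≠ 0) : β (a • p + b • q) (c • p + d • q) := by
  have := β.subst' (θ := fun i => if i = 0 then p else q)
    (fun i => by split_ifs <;> assumption) h
  simpa using this

/-- A nontrivial step in a join comes from a nontrivial step in one of the joinands. -/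
theorem exists_of_sup {β γ : FullyInvCongr} (h : (β ⊔ γ) u v) (hne : u ≠ v) :
    ∃ w, u ≠ w ∧ (β u w ∨ γ u w) := by
  rw [sup_iff] at h
  induction h using Relation.ReflTransGen.head_induction_on with
  | refl => exact absurd rfl hne
  | @head a c h _ ih =>
    by_cases hac : a = c
    · subst hac; exact ih hne
    · exact ⟨c, hac, h⟩

end Basic

/-- The Rees congruence of a fully invariant ideal. -/
def rees (I : CWord → Prop) (h0 : ¬ I 0) (hadd : ∀ u w, I u → I (u + w))
    (hsubst : ∀ u θ, (∀ i, θ i ≠ 0) → I u → I (subst θ u)) : FullyInvCongr where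
  rel u v := u = v ∨ I u ∧ I v
  refl' _ := .inl rfl
  symm' h := h.imp Eq.symm And.symm
  trans' := by
    rintro u v w (rfl | h) (rfl | h')
    exacts [.inl rfl, .inr h', .inr h, .inr ⟨h.1, h'.2⟩]
  add_right' w h := h.imp (congrArg (· + w)) fun h => ⟨hadd _ _ h.1, hadd _ _ h.2⟩
  subst' {u v θ} hθ h := h.imp (congrArg (subst θ)) fun h => ⟨hsubst _ _ hθ h.1, hsubst _ _ hθ h.2⟩
  eq_zero' h := h.elim Eq.symm fun h => absurd h.1 h0

/-- The congruence identifying words whose multiplicities agree up to truncation at `k + 1`. -/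
def trunc (k : ℕ) : FullyInvCongr where
  rel u v := ∀ i, min (u i) (k + 1) = min (v i) (k + 1)
  refl' _ _ := rfl
  symm' h i := (h i).symm
  trans' h h' i := (h i).trans (h' i)
  add_right' w h i := by
    have := h i
    simp only [Finsupp.add_apply]
    omega
  subst' {u v θ} _ h i := by
    rw [subst_apply_of_subset θ u (s := u.support ∪ v.support) Finset.subset_union_left,
      subst_apply_of_subset θ v (s := u.support ∪ v.support) Finset.subset_union_right]
    induction u.support ∪ v.support using Finset.induction_on with
    | empty => rfl
    | insert a s ha ih =>
      rw [Finset.sum_insert ha, Finset.sum_insert ha]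
      have h1 : min (u a * θ a i) (k + 1) = min (v a * θ a i) (k + 1) := by
        rcases Nat.eq_zero_or_pos (θ a i) with h0 | h0
        · simp [h0]
        · have h2 := h a
          by_cases h3 : u a = v a
          · rw [h3]
          · have h4 : k + 1 ≤ u a := by omega
            have h5 : k + 1 ≤ v a := by omega
            rw [min_eq_right (h4.trans (Nat.le_mul_of_pos_right _ h0)),
              min_eq_right (h5.trans (Nat.le_mul_of_pos_right _ h0))]
      omega
  eq_zero' {v} h := by
    ext i
    have := h i
    simp only [Finsupp.zero_apply] at this ⊢
    omega

/-- The congruence identifying words with the same letters. -/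
abbrev content : FullyInvCongr := trunc 0

theorem content_iff {u v : CWord} : content u v ↔ ∀ i, u i ≠ 0 ↔ v i ≠ 0 := by
  refine forall_congr' fun i => ?_
  omega

/-- The congruence identifying words whose multiplicities are congruent modulo `m`. -/
def modulo (m : ℕ) : FullyInvCongr where
  rel u v := (u = 0 ↔ v = 0) ∧ ∃ p q : CWord, u + m • p = v + m • q
  refl' _ := ⟨Iff.rfl, 0, 0, rfl⟩
  symm' := fun ⟨h, p, q, e⟩ => ⟨h.symm, q, p, e.symm⟩
  trans' := fun {u v w} ⟨h, p, q, e⟩ ⟨h', p', q', e'⟩ => ⟨h.trans h', p + p', q + q', by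
    rw [smul_add, smul_add, ← add_assoc, e, add_right_comm, e']
    abel⟩
  add_right' := fun w ⟨h, p, q, e⟩ => ⟨(⊤ : FullyInvCongr).add_right' w h, p, q, by
    rw [add_right_comm, e, add_right_comm]⟩
  subst' := fun {u v θ} hθ ⟨h, p, q, e⟩ => ⟨(⊤ : FullyInvCongr).subst' hθ h,
    subst θ p, subst θ q, by
      rw [← map_nsmul, ← map_nsmul, ← map_add, ← map_add, e]⟩
  eq_zero' h := h.1.1 rfl

/-- The congruence annihilating the words of degree greater than `n` and identifying the words
of degree `n` with the same letters. -/
def layer (n : ℕ) : FullyInvCongr where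
  rel u v := u = v ∨ (n < u.degree ∧ n < v.degree) ∨
    (u.degree = n ∧ v.degree = n ∧ content u v)
  refl' _ := .inl rfl
  symm' h := h.imp Eq.symm (Or.imp And.symm fun h => ⟨h.2.1, h.1, content.symm' h.2.2⟩)
  trans' := by
    rintro u v w (rfl | h | h) (rfl | h' | h')
    · exact .inl rfl
    · exact .inr (.inl h')
    · exact .inr (.inr h')
    · exact .inr (.inl h)
    · exact .inr (.inl ⟨h.1, h'.2⟩)
    · omega
    · exact .inr (.inr h)
    · omega
    · exact .inr (.inr ⟨h.1, h'.2.1, content.trans' h.2.2 h'.2.2⟩)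
  add_right' {u v} w h := by
    rcases h with rfl | h | h
    · exact .inl rfl
    · right; left; simp only [map_add]; omega
    · by_cases hw : w = 0
      · subst hw; simpa using Or.inr (Or.inr h)
      · have := degree_pos hw
        right; left; simp only [map_add]; omega
  subst' {u v θ} hθ h := by
    rcases h with rfl | h | h
    · exact .inl rfl
    · exact .inr (.inl ⟨h.1.trans_le (degree_le_degree_subst hθ _),
        h.2.trans_le (degree_le_degree_subst hθ _)⟩)
    · have h1 := content_iff.1 h.2.2
      by_cases h2 : ∀ i, u i ≠ 0 → (θ i).degree = 1
      · refine .inr (.inr ⟨?_, ?_, content.subst' hθ h.2.2⟩)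
        · rw [← h.1, degree_subst, degree_eq_sum]
          exact Finset.sum_congr rfl fun i hi => by
            rw [h2 i (Finsupp.mem_support_iff.1 hi), mul_one]
        · rw [← h.2.1, degree_subst, degree_eq_sum]
          exact Finset.sum_congr rfl fun i hi => by
            rw [h2 i ((h1 i).2 (Finsupp.mem_support_iff.1 hi)), mul_one]
      · push Not at h2
        obtain ⟨i, hi, hd⟩ := h2
        have h3 : 1 < (θ i).degree := lt_of_le_of_ne (degree_pos (hθ i)) (Ne.symm hd)
        have key : ∀ w : CWord, w i ≠ 0 → w.degree < (subst θ w).degree := fun w hw => by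
          rw [degree_subst, degree_eq_sum]
          refine Finset.sum_lt_sum
            (fun j _ => Nat.le_mul_of_pos_right _ (degree_pos (hθ j)))
            ⟨i, Finsupp.mem_support_iff.2 hw, ?_⟩
          exact (Nat.lt_mul_iff_one_lt_right (Nat.pos_of_ne_zero hw)).2 h3
        exact .inr (.inl ⟨h.1 ▸ key u hi, by have := key v ((h1 i).1 hi); omega⟩)
  eq_zero' {v} h := by
    rcases h with h | h | h
    · exact h.symm
    · simp at h
    · rw [map_zero] at h
      exact (Finsupp.degree_eq_zero_iff v).1 (by omega)

end FullyInvCongr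

namespace CWord

theorem subst_update_add (i : ℕ) (r w : CWord) :
    subst (Function.update letter i (letter i + r)) w = w + w i • r := by
  induction w using Finsupp.induction_linear with
  | zero => simp
  | add f g hf hg => rw [map_add, hf, hg, Finsupp.add_apply, add_smul]; abel
  | single a b =>
    rcases eq_or_ne a i with rfl | h
    · simp
    · simp [h]

theorem update_letter_ne_zero {r : CWord} (hr : r ≠ 0) (i : ℕ) (j : ℕ) :
    Function.update letter i r j ≠ 0 := by
  rcases eq_or_ne j i with rfl | h
  · simpa using hr
  · simp [Function.update_of_ne h]

theorem subst_letter_comp (f : ℕ → ℕ) (w : CWord) :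
    subst (fun i => letter (f i)) w = w.mapDomain f := by
  simp [subst, Finsupp.linearCombination_apply, Finsupp.mapDomain]

/-- A thick word is a proper multiple of the square of a letter. -/
def Thick (w : CWord) : Prop := ∃ i q, q ≠ 0 ∧ w = 2 • letter i + q

theorem Thick.ne_zero {w : CWord} (h : Thick w) : w ≠ 0 := by
  obtain ⟨i, q, hq, rfl⟩ := h
  simp [hq]

theorem Thick.add {w : CWord} (h : Thick w) (r : CWord) : Thick (w + r) := by
  obtain ⟨i, q, hq, rfl⟩ := h
  exact ⟨i, q + r, by simp [hq], add_assoc _ _ _⟩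

theorem thick_smul {u : CWord} (hu : u ≠ 0) {n : ℕ} (hn : 3 ≤ n) : Thick (n • u) := by
  obtain ⟨i, hi⟩ := exists_ne_zero hu
  obtain ⟨q, rfl⟩ := eq_smul_letter_add (Nat.one_le_iff_ne_zero.2 hi)
  obtain ⟨m, rfl⟩ := Nat.exists_eq_add_of_le' hn
  refine ⟨i, (m + 1) • letter i + (m + 3) • q, by simp, ?_⟩
  rw [smul_add, one_smul, ← add_assoc, ← add_smul]
  congr 2
  omega

theorem not_thick {u : CWord} (h : ¬ Thick u) : (∀ i, u i ≤ 1) ∨ ∃ i, u = 2 • letter i := by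
  by_contra! hc
  obtain ⟨⟨i, hi⟩, h'⟩ := hc
  obtain ⟨q, rfl⟩ := eq_smul_letter_add (show 2 ≤ u i from hi)
  exact h ⟨i, q, fun hq => h' i (by rw [hq, add_zero]), rfl⟩

end CWord

namespace FullyInvCongr

variable (β : FullyInvCongr) {u v w : CWord}

theorem add_smul_of_eq_zero (r : CWord) (h : β u v) {i : ℕ} (hu : u i = 0) :
    β v (v + v i • r) := by
  have h1 := β.subst' (update_letter_ne_zero (r := letter i + r) (by simp) i) h
  rw [subst_update_add, subst_update_add, hu, zero_smul, add_zero] at h1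
  exact β.trans' (β.symm' h) h1

theorem exists_add_smul_of_not_content (h : β u v) (hc : ¬ content u v) :
    ∃ m, 1 ≤ m ∧ ∀ r, β u (u + m • r) := by
  rw [content_iff] at hc
  push Not at hc
  obtain ⟨i, hi⟩ := hc
  rcases Nat.eq_zero_or_pos (u i) with h0 | h0
  · exact ⟨v i, by omega, fun r =>
      β.trans' (β.trans' h (β.add_smul_of_eq_zero r h h0)) (β.add_right' _ (β.symm' h))⟩
  · exact ⟨u i, h0, fun r => β.add_smul_of_eq_zero r (β.symm' h) (by omega)⟩

theorem exists_add_smul_self_of_le_one (hu : ∀ i, u i ≤ 1) {t : CWord} (ht : t ≠ 0)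
    (hs : ∀ i, t i ≠ 0 → u i ≠ 0) (h : β u (u + t)) : ∃ c, 1 ≤ c ∧ β u (u + c • u) := by
  classical
  obtain ⟨i, hi⟩ := exists_ne_zero ht
  let π (σ : Equiv.Perm u.support) : Equiv.Perm ℕ := Equiv.Perm.ofSubtype σ
  have hπ : ∀ σ : Equiv.Perm u.support, u.mapDomain (π σ).symm = u := by
    intro σ
    ext l
    rw [Finsupp.mapDomain_equiv_apply, Equiv.symm_symm]
    by_cases hl : l ∈ u.support
    · have h1 : π σ l ∈ u.support := by
        simp only [π]
        rw [Equiv.Perm.ofSubtype_apply_of_mem _ hl]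
        exact (σ _).2
      have h2 := hu l
      have h3 := hu (π σ l)
      rw [Finsupp.mem_support_iff] at hl h1
      omega
    · simp only [π]
      rw [Equiv.Perm.ofSubtype_apply_of_not_mem _ hl]
  have h1 : ∀ s : Finset (Equiv.Perm u.support),
      β u (u + ∑ σ ∈ s, t.mapDomain (π σ).symm) := by
    intro s
    induction s using Finset.induction_on with
    | empty => simpa using β.refl' u
    | insert σ s hσ ih =>
      have h2 := β.subst' (θ := fun i => letter ((π σ).symm i)) (fun _ => letter_ne_zero _) h
      rw [subst_letter_comp, subst_letter_comp, Finsupp.mapDomain_add, hπ] at h2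
      rw [Finset.sum_insert hσ, add_comm (t.mapDomain _), ← add_assoc]
      exact β.trans' h2 (β.add_right' _ ih)
  have hiu : i ∈ u.support := Finsupp.mem_support_iff.2 (hs i hi)
  refine ⟨∑ σ, t (π σ i), ?_, ?_⟩
  · refine (Nat.one_le_iff_ne_zero.2 hi).trans ?_
    have := Finset.single_le_sum (f := fun σ => t (π σ i)) (fun _ _ => Nat.zero_le _)
      (Finset.mem_univ 1)
    simpa [π] using this
  · convert h1 Finset.univ using 2
    ext l
    simp only [Finsupp.smul_apply, Finsupp.finsetSum_apply, Finsupp.mapDomain_equiv_apply,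
      Equiv.symm_symm, smul_eq_mul]
    by_cases hl : l ∈ u.support
    · have h2 : u l = 1 := by
        have := hu l
        rw [Finsupp.mem_support_iff] at hl
        omega
      rw [h2, mul_one]
      refine Fintype.sum_equiv (Equiv.mulRight (Equiv.swap ⟨l, hl⟩ ⟨i, hiu⟩)) _ _ fun σ => ?_
      simp only [π, Equiv.coe_mulRight]
      rw [Equiv.Perm.ofSubtype_apply_of_mem _ hl, Equiv.Perm.ofSubtype_apply_of_mem _ hiu]
      simp
    · have h2 : u l = 0 := Finsupp.notMem_support_iff.1 hl
      rw [h2, mul_zero, eq_comm]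
      refine Finset.sum_eq_zero fun σ _ => ?_
      simp only [π]
      rw [Equiv.Perm.ofSubtype_apply_of_not_mem _ hl]
      by_contra h3
      exact hs l h3 h2

theorem exists_add_smul_self (hu : ¬ Thick u) (h : β u v) (hne : u ≠ v) :
    ∃ c, 1 ≤ c ∧ β u (u + c • u) := by
  by_cases hc : content u v
  · rw [content_iff] at hc
    rcases not_thick hu with hu | ⟨i, rfl⟩
    · obtain ⟨t, rfl⟩ : ∃ t, v = u + t := exists_add_of_le fun i => by
        have := hu i
        have := hc i
        omega
      refine β.exists_add_smul_self_of_le_one hu (by simpa using hne) (fun i hi => ?_) h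
      rw [hc, Finsupp.add_apply]
      omega
    · obtain ⟨k, hk, rfl⟩ : ∃ k, 1 ≤ k ∧ v = k • letter i := by
        refine ⟨v i, Nat.one_le_iff_ne_zero.2 ((hc i).1 (by simp)), ?_⟩
        ext j
        rcases eq_or_ne i j with rfl | hj
        · simp
        · have := hc j
          simp_all
      rcases Nat.lt_or_ge k 2 with h2 | h2
      · obtain rfl : k = 1 := by omega
        refine ⟨1, le_rfl, ?_⟩
        have h3 := β.add h h
        rw [← add_smul (1 : ℕ)] at h3
        simpa using β.symm' h3
      · obtain ⟨d, rfl⟩ := Nat.exists_eq_add_of_le h2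
        refine ⟨d, Nat.one_le_iff_ne_zero.2 (by rintro rfl; exact hne rfl), ?_⟩
        rw [add_smul] at h
        have h3 := β.add_nsmul h 2
        rwa [smul_comm] at h3
  · obtain ⟨m, hm, h1⟩ := β.exists_add_smul_of_not_content h hc
    exact ⟨m, hm, h1 u⟩

end FullyInvCongr

theorem isNeutralElt_of_le {α : Type*} [Lattice α] {x : α}
    (h : ∀ y z, (x ⊔ y) ⊓ (y ⊔ z) ⊓ (z ⊔ x) ≤ (x ⊓ y) ⊔ (y ⊓ z) ⊔ (z ⊓ x)) :
    IsNeutralElt x := fun y z => by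
  refine le_antisymm (h y z) (sup_le (sup_le ?_ ?_) ?_)
  · exact le_inf (le_inf (inf_le_left.trans le_sup_left) (inf_le_right.trans le_sup_left))
      (inf_le_left.trans le_sup_right)
  · exact le_inf (le_inf (inf_le_left.trans le_sup_right) (inf_le_left.trans le_sup_left))
      (inf_le_right.trans le_sup_left)
  · exact le_inf (le_inf (inf_le_right.trans le_sup_left) (inf_le_left.trans le_sup_right))
      (inf_le_left.trans le_sup_left)

namespace FullyInvCongr

section Rees

variable {I : CWord → Prop} {β γ : FullyInvCongr} {u v : CWord}

theorem exists_common (hI : ∀ u, Thick u → I u) {v v' : CWord} (h : β u v) (h' : γ u v')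
    (hne : ¬ I u → u ≠ v) (hne' : ¬ I u → u ≠ v') : ∃ w, I w ∧ β u w ∧ γ u w := by
  by_cases hu : I u
  · exact ⟨u, hu, β.refl' u, γ.refl' u⟩
  · have hu' : ¬ Thick u := mt (hI u) hu
    have h0 : u ≠ 0 := β.ne_zero h (hne hu)
    obtain ⟨c, hc, h1⟩ := β.exists_add_smul_self hu' h (hne hu)
    obtain ⟨d, hd, h2⟩ := γ.exists_add_smul_self hu' h' (hne' hu)
    refine ⟨u + (2 * d * c) • u, hI _ ?_, ?_, ?_⟩
    · have h3 : u + (2 * d * c) • u = (1 + 2 * d * c) • u := by rw [add_smul, one_smul]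
      rw [h3]
      refine thick_smul h0 ?_
      have := Nat.mul_le_mul hd hc
      rw [mul_assoc]
      omega
    · rw [mul_smul]
      exact β.add_nsmul h1 _
    · rw [mul_right_comm, mul_smul]
      exact γ.add_nsmul h2 _

theorem exists_of_step (hI : ∀ u, Thick u → I u) {w : CWord} (hw : I w) (h : β w u)
    (h' : γ u v) : ∃ w', I w' ∧ β w w' ∧ (β w' v ∨ γ w' v) := by
  rcases eq_or_ne u v with rfl | hne
  · exact ⟨w, hw, β.refl' w, .inl h⟩
  · obtain ⟨w', h1, h2, h3⟩ := exists_common hI (β.symm' h) h'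
      (fun hu => by rintro rfl; exact hu hw) (fun _ => hne)
    exact ⟨w', h1, β.trans' h h2, .inr (γ.trans' (γ.symm' h3) h')⟩

variable {h0 : ¬ I 0} {hadd : ∀ u w, I u → I (u + w)}
  {hsubst : ∀ u θ, (∀ i, θ i ≠ 0) → I u → I (subst θ u)}

theorem of_rees_sup (h : (rees I h0 hadd hsubst ⊔ β) u v) :
    β u v ∨ ∃ u' v', I u' ∧ I v' ∧ β u u' ∧ β v v' := by
  rw [sup_iff] at h
  induction h with
  | refl => exact .inl (β.refl' u)
  | @tail b c _ h ih =>
    rcases h with (rfl | ⟨hb, hc⟩) | h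
    · exact ih
    · rcases ih with ih | ⟨u', v', hu, hv, h1, h2⟩
      · exact .inr ⟨b, c, hb, hc, ih, β.refl' c⟩
      · exact .inr ⟨u', c, hu, hc, h1, β.refl' c⟩
    · rcases ih with ih | ⟨u', v', hu, hv, h1, h2⟩
      · exact .inl (β.trans' ih h)
      · exact .inr ⟨u', v', hu, hv, h1, β.trans' (β.symm' h) h2⟩

theorem isNeutralElt_rees (hI : ∀ u, Thick u → I u) :
    IsNeutralElt (rees I h0 hadd hsubst) := by
  refine isNeutralElt_of_le fun β γ u v ⟨⟨h1, h2⟩, h3⟩ => ?_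
  set α := rees I h0 hadd hsubst
  set δ := (α ⊓ β) ⊔ (β ⊓ γ) ⊔ (γ ⊓ α)
  have hβ : ∀ {p q}, I p → I q → β p q → δ p q := fun hp hq h =>
    mono (β := α ⊓ β) (le_sup_of_le_left le_sup_left) ⟨.inr ⟨hp, hq⟩, h⟩
  have hγ : ∀ {p q}, I p → I q → γ p q → δ p q := fun hp hq h =>
    mono (β := γ ⊓ α) le_sup_right ⟨h, .inr ⟨hp, hq⟩⟩
  have hβγ : ∀ {p q}, β p q → γ p q → δ p q := fun h h' =>
    mono (β := β ⊓ γ) (le_sup_of_le_left le_sup_right) ⟨h, h'⟩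
  have hchain : ∀ {p q}, I p → I q → (β ⊔ γ) p q → δ p q := by
    intro p q hp hq h
    have : ∃ q', I q' ∧ δ p q' ∧ (β q' q ∨ γ q' q) := by
      clear hq
      rw [sup_iff] at h
      induction h with
      | refl => exact ⟨p, hp, δ.refl' p, .inl (β.refl' p)⟩
      | tail _ h ih =>
        obtain ⟨w, hw, hpw, h4⟩ := ih
        rcases h with h | h <;> rcases h4 with h4 | h4
        · exact ⟨w, hw, hpw, .inl (β.trans' h4 h)⟩
        · obtain ⟨w', hw', h5, h6⟩ := exists_of_step hI hw h4 h
          exact ⟨w', hw', δ.trans' hpw (hγ hw hw' h5), h6.symm⟩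
        · obtain ⟨w', hw', h5, h6⟩ := exists_of_step hI hw h4 h
          exact ⟨w', hw', δ.trans' hpw (hβ hw hw' h5), h6⟩
        · exact ⟨w, hw, hpw, .inr (γ.trans' h4 h)⟩
    obtain ⟨q', hq', h5, h6⟩ := this
    exact δ.trans' h5 (h6.elim (hβ hq' hq) (hγ hq' hq))
  have hfin : (∃ w, I w ∧ β u w ∧ γ u w) → (∃ w, I w ∧ β v w ∧ γ v w) → δ u v := by
    rintro ⟨w, hw, h4, h5⟩ ⟨w', hw', h6, h7⟩
    refine δ.trans' (hβγ h4 h5) (δ.trans' (hchain hw hw' ?_) (δ.symm' (hβγ h6 h7)))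
    exact (β ⊔ γ).trans' (mono le_sup_left (β.symm' h4))
      ((β ⊔ γ).trans' h2 (mono le_sup_left h6))
  rcases eq_or_ne u v with rfl | hne
  · exact δ.refl' u
  have aux : ∀ {p q}, ¬ I p → I q → p ≠ q := fun hp hq h => hp (h ▸ hq)
  rw [sup_comm] at h3
  rcases of_rees_sup h1 with h4 | ⟨u1, v1, hu1, hv1, h5, h6⟩ <;>
    rcases of_rees_sup h3 with h7 | ⟨u2, v2, hu2, hv2, h8, h9⟩
  · exact hβγ h4 h7
  · exact hfin (exists_common hI h4 h8 (fun _ => hne) (aux · hu2))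
      (exists_common hI (β.symm' h4) h9 (fun _ => hne.symm) (aux · hv2))
  · exact hfin (exists_common hI h5 h7 (aux · hu1) (fun _ => hne))
      (exists_common hI h6 (γ.symm' h7) (aux · hv1) (fun _ => hne.symm))
  · exact hfin (exists_common hI h5 h8 (aux · hu1) (aux · hu2))
      (exists_common hI h6 h9 (aux · hv1) (aux · hv2))

end Rees

end FullyInvCongr

namespace FullyInvCongr

section Content

variable {β γ δ : FullyInvCongr} {u v : CWord}

theorem content_sup_cases (hγ : γ ≤ content) (hβδ : content ⊓ β ≤ δ) (hγδ : γ ≤ δ)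
    (h : (β ⊔ γ) u v) : content u v ∧ δ u v ∨ ∃ m, 1 ≤ m ∧ δ u (u + m • u) := by
  rw [sup_iff] at h
  induction h with
  | refl => exact .inl ⟨content.refl' u, δ.refl' u⟩
  | @tail w w' _ h ih =>
    rcases ih with ⟨hc, ih⟩ | ih
    · rcases h with h | h
      · by_cases hw : content w w'
        · exact .inl ⟨content.trans' hc hw, δ.trans' ih (mono hβδ ⟨hw, h⟩)⟩
        · obtain ⟨m, hm, hr⟩ := β.exists_add_smul_of_not_content h hw
          refine .inr ⟨m, hm, ?_⟩
          have h1 : δ w (w + m • u) := mono hβδ ⟨content_iff.2 fun i => by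
            have := content_iff.1 hc i
            simp only [Finsupp.add_apply, Finsupp.smul_apply, smul_eq_mul, ne_eq,
              Nat.add_eq_zero_iff, mul_eq_zero]
            tauto, hr u⟩
          exact δ.trans' (δ.trans' ih h1) (δ.symm' (δ.add_right' _ ih))
      · exact .inl ⟨content.trans' hc (mono hγ h), δ.trans' ih (mono hγδ h)⟩
    · exact .inr ih

theorem content_inf_sup_le (hγ : γ ≤ content) (hβδ : content ⊓ β ≤ δ) (hγδ : γ ≤ δ)
    (h : (β ⊔ γ) u v) (hc : content u v) : δ u v := by
  rcases eq_or_ne u v with rfl | hne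
  · exact δ.refl' u
  have hu0 : u ≠ 0 := (β ⊔ γ).ne_zero h hne
  have hc' := content_iff.1 hc
  have step : ∀ s, content u s → δ (u + s) (v + s) := by
    intro s hs
    have hs' := content_iff.1 hs
    let θ : ℕ → CWord := fun i => if u i = 0 then u else letter i
    have hθ : ∀ i, θ i ≠ 0 := fun i => by
      simp only [θ]
      split_ifs
      exacts [hu0, letter_ne_zero i]
    have hθu : subst θ u = u := subst_eq_self fun i hi => if_neg hi
    have hθv : subst θ v = v := subst_eq_self fun i hi => if_neg ((hc' i).2 hi)
    have hcont : ∀ w, content (subst θ w + s) s := fun w => content_iff.2 fun i => by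
      refine ⟨fun hi hsi => ?_, fun hi => by rw [Finsupp.add_apply]; omega⟩
      rw [Finsupp.add_apply, hsi, add_zero, subst_apply] at hi
      obtain ⟨j, _, hj⟩ := Finset.exists_ne_zero_of_sum_ne_zero hi
      have h1 : u i = 0 := by
        by_contra h1
        exact (hs' i).1 h1 hsi
      simp only [θ] at hj
      split_ifs at hj with h2
      · simp [h1] at hj
      · obtain ⟨-, rfl⟩ : w j ≠ 0 ∧ j = i := by
          rcases eq_or_ne j i with h3 | h3 <;> simp_all
        exact h2 h1
    suffices ∀ w, (β ⊔ γ) u w → δ (u + s) (subst θ w + s) by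
      simpa [hθv] using this v h
    intro w hw
    rw [sup_iff] at hw
    induction hw with
    | refl => rw [hθu]; exact δ.refl' _
    | @tail w w' _ hw ih =>
      refine δ.trans' ih ?_
      rcases hw with hw | hw
      · exact mono hβδ ⟨content.trans' (hcont w) (content.symm' (hcont w')),
          β.add_right' s (β.subst' hθ hw)⟩
      · exact mono hγδ (γ.add_right' s (γ.subst' hθ hw))
  have hadd : ∀ s, content u s → ∀ r, (∀ i, r i ≠ 0 → u i ≠ 0) → content u (r + s) := by
    intro s hs r hr
    refine content_iff.2 fun i => ?_
    have h1 := content_iff.1 hs i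
    have h2 := hr i
    rw [Finsupp.add_apply]
    omega
  have steps : ∀ s, content u s → ∀ n : ℕ, δ (n • u + s) (n • v + s) := by
    intro s hs n
    induction n with
    | zero => simpa using δ.refl' s
    | succ n ih =>
      have h1 := step _ (hadd s hs (n • u) fun i hi h0 => hi (by simp [h0]))
      have h2 := δ.trans' h1 (δ.add_left v ih)
      convert h2 using 1 <;> rw [succ_nsmul'] <;> abel
  rcases content_sup_cases hγ hβδ hγδ h with h1 | ⟨m, hm, h1⟩
  · exact h1.2
  rcases content_sup_cases hγ hβδ hγδ ((β ⊔ γ).symm' h) with h2 | ⟨k, hk, h2⟩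
  · exact δ.symm' h2.2
  have hmul : ∀ p : CWord, content u p → content u (p + (k * m) • u + (k * m) • v) := by
    intro p hp
    rw [add_assoc, add_comm]
    refine hadd p hp _ fun i hi h0 => hi ?_
    have : v i = 0 := by
      by_contra h3
      exact (hc' i).2 h3 h0
    simp [h0, this]
  have e1 : δ u (u + ((k * m) • u + (k * m) • v)) := by
    have h3 := δ.add_nsmul h1 (2 * k)
    have h4 := steps (u + (k * m) • u) (by
      rw [add_comm]
      exact hadd u (content.refl' u) _ fun i hi h0 => hi (by simp [h0])) (k * m)
    refine δ.trans' h3 ?_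
    convert h4 using 1
    · rw [smul_smul, mul_assoc, two_mul, add_smul]; abel
    · abel
  have e2 : δ v (v + ((k * m) • u + (k * m) • v)) := by
    have h3 := δ.add_nsmul h2 (2 * m)
    have h4 := steps (v + (k * m) • v) (by
      rw [add_comm]
      exact hadd v hc _ fun i hi h0 => hi (by
        have : v i = 0 := by
          by_contra h3
          exact (hc' i).2 h3 h0
        simp [this])) (k * m)
    refine δ.trans' h3 (δ.symm' ?_)
    convert h4 using 1
    · abel
    · rw [smul_smul, mul_assoc, mul_comm m k, two_mul, add_smul]; abel
  refine δ.trans' e1 (δ.trans' (step _ ?_) (δ.symm' e2))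
  have hk : 1 ≤ k * m := Nat.mul_pos hk hm
  refine content_iff.2 fun i => ?_
  have h5 := hc' i
  have h6 : k * m ≠ 0 := by omega
  simp only [Finsupp.add_apply, Finsupp.smul_apply, smul_eq_mul, ne_eq,
    Nat.add_eq_zero_iff, mul_eq_zero] at h6 ⊢
  tauto

theorem le_of_not_le_content (hβδ : content ⊓ β ≤ δ) {a b : ℕ} (hb : b ≠ 0)
    (hab : ∀ y r : CWord, y ≠ 0 → r ≠ 0 → (β ⊓ δ) (a • y) (a • y + b • r)) : β ≤ δ := by
  intro p q h
  by_cases hc : content p q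
  · exact mono hβδ ⟨hc, h⟩
  have hne : p ≠ q := by
    rintro rfl
    exact hc (content.refl' p)
  have key : ∀ {p q}, β p q → ¬ content p q → p ≠ 0 → q ≠ 0 →
      ∃ m : ℕ, (β ⊓ δ) p (p + m • p + b • q) := by
    intro p q h hc hp hq
    obtain ⟨m, hm, h1⟩ := β.exists_add_smul_of_not_content h hc
    have h2 : (β ⊓ δ) p (p + m • p) := ⟨h1 p, mono hβδ ⟨content_iff.2 fun i => by
      simp only [Finsupp.add_apply, Finsupp.smul_apply, smul_eq_mul, ne_eq,
        Nat.add_eq_zero_iff, mul_eq_zero]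
      tauto, h1 p⟩⟩
    refine ⟨a * m, (β ⊓ δ).trans' ((β ⊓ δ).add_nsmul h2 a) ?_⟩
    rw [add_assoc, mul_smul]
    refine (β ⊓ δ).add_left p (hab _ q ?_ hq)
    rw [Ne, smul_eq_zero]
    rintro (h | h)
    exacts [by omega, hp h]
  have hp := β.ne_zero h hne
  have hq := β.ne_zero (β.symm' h) hne.symm
  obtain ⟨m, h1, h2⟩ := key h hc hp hq
  obtain ⟨k, h3, h4⟩ := key (β.symm' h) (mt content.symm' hc) hq hp
  refine δ.trans' h2 (δ.trans' (mono hβδ ⟨?_, ?_⟩) (δ.symm' h4))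
  · refine content_iff.2 fun i => ?_
    simp only [Finsupp.add_apply, Finsupp.smul_apply, smul_eq_mul, ne_eq,
      Nat.add_eq_zero_iff, mul_eq_zero]
    tauto
  · exact β.trans' (β.symm' h1) (β.trans' h h3)

theorem exists_absorb_of_not_le_content (hβ : ¬ β ≤ content) (hγ : ¬ γ ≤ content) :
    ∃ a b : ℕ, b ≠ 0 ∧
      ∀ y r : CWord, y ≠ 0 → r ≠ 0 → (β ⊓ γ) (a • y) (a • y + b • r) := by
  have aux : ∀ {β : FullyInvCongr}, ¬ β ≤ content →
      ∃ s m, 1 ≤ m ∧ ∀ r : CWord, β s (s + m • r) := by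
    intro β hβ
    simp only [LE.le, not_forall] at hβ
    obtain ⟨p, q, h, hc⟩ := hβ
    exact ⟨p, β.exists_add_smul_of_not_content h hc⟩
  obtain ⟨s, m, hm, h1⟩ := aux hβ
  obtain ⟨t, k, hk, h2⟩ := aux hγ
  refine ⟨(s + t).degree, m * k, (Nat.mul_pos hm hk).ne', fun y r hy hr => ?_⟩
  obtain ⟨j, hj⟩ := Infinite.exists_notMem_finset (s + t).support
  rw [Finsupp.notMem_support_iff] at hj
  have h3 : (β ⊓ γ) (s + t) (s + t + (m * k) • letter j) := by
    refine ⟨?_, ?_⟩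
    · rw [add_right_comm, mul_smul]
      exact β.add_right' t (h1 _)
    · rw [add_assoc, mul_comm, mul_smul]
      exact γ.add_left s (h2 _)
  have h4 := (β ⊓ γ).subst' (θ := Function.update (fun _ => y) j r) (fun i => by
    rcases eq_or_ne i j with rfl | h
    · simpa using hr
    · simpa [h] using hy) h3
  have h5 : subst (Function.update (fun _ => y) j r) (s + t) = (s + t).degree • y := by
    rw [← subst_const]
    refine subst_congr fun i hi => Function.update_of_ne ?_ _ _
    rintro rfl
    exact hi hj
  rw [map_add _ (s + t), map_nsmul, h5] at h4
  simpa using h4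

theorem isNeutralElt_content : IsNeutralElt content := by
  refine isNeutralElt_of_le fun β γ u v ⟨⟨h1, h2⟩, h3⟩ => ?_
  set δ := (content ⊓ β) ⊔ (β ⊓ γ) ⊔ (γ ⊓ content)
  have hβ : content ⊓ β ≤ δ := le_sup_of_le_left le_sup_left
  have hγ : content ⊓ γ ≤ δ := by rw [inf_comm]; exact le_sup_right
  have hβγ : β ⊓ γ ≤ δ := le_sup_of_le_left le_sup_right
  by_cases hγσ : γ ≤ content
  · refine content_inf_sup_le hγσ hβ ((le_inf hγσ le_rfl).trans hγ) h2 ?_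
    rwa [sup_eq_right.2 hγσ] at h3
  by_cases hβσ : β ≤ content
  · refine content_inf_sup_le hβσ hγ ((le_inf hβσ le_rfl).trans hβ) ?_ ?_
    · rwa [sup_comm]
    · rwa [sup_eq_left.2 hβσ] at h1
  obtain ⟨a, b, hb, hab⟩ := exists_absorb_of_not_le_content hβσ hγσ
  exact mono (sup_le (le_of_not_le_content hβ hb fun y r hy hr =>
    ⟨(hab y r hy hr).1, mono hβγ (hab y r hy hr)⟩)
    (le_of_not_le_content hγ hb fun y r hy hr =>
    ⟨(hab y r hy hr).2, mono hβγ (hab y r hy hr)⟩)) h2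

end Content

end FullyInvCongr

namespace CWord

theorem subst_subst (θ η : ℕ → CWord) (u : CWord) :
    subst θ (subst η u) = subst (fun i => subst θ (η i)) u := by
  induction u using Finsupp.induction_linear with
  | zero => simp
  | add f g hf hg => rw [map_add, map_add, hf, hg, map_add]
  | single a b => simp

/-- The word `x^a y^b` in the first two letters. -/
noncomputable def duo (a b : ℕ) : CWord := a • letter 0 + b • letter 1

theorem subst_duo (θ : ℕ → CWord) (a b : ℕ) : subst θ (duo a b) = a • θ 0 + b • θ 1 := by
  simp [duo]

theorem duo_add (a b c d : ℕ) : duo a b + duo c d = duo (a + c) (b + d) := by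
  simp only [duo, add_smul]
  abel

theorem smul_duo (n a b : ℕ) : n • duo a b = duo (n * a) (n * b) := by
  simp only [duo, smul_add, smul_smul]

theorem degree_duo (a b : ℕ) : (duo a b).degree = a + b := by
  simp [duo]

theorem duo_zero (a b : ℕ) : duo a b 0 = a := by simp [duo]

theorem duo_one (a b : ℕ) : duo a b 1 = b := by simp [duo]

theorem duo_apply (a b : ℕ) {i : ℕ} (h0 : i ≠ 0) (h1 : i ≠ 1) : duo a b i = 0 := by
  simp [duo, h0.symm, h1.symm]

theorem eq_duo {w : CWord} (h : ∀ i, w i ≠ 0 → i = 0 ∨ i = 1) : w = duo (w 0) (w 1) := by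
  ext i
  by_cases h0 : i = 0
  · rw [h0, duo_zero]
  by_cases h1 : i = 1
  · rw [h1, duo_one]
  rw [duo_apply _ _ h0 h1]
  by_contra h2
  exact (h i h2).elim h0 h1

theorem eq_zero_or_one_of_duo {a b i : ℕ} (h : duo a b i ≠ 0) : i = 0 ∨ i = 1 := by
  by_contra! hc
  exact h (duo_apply a b hc.1 hc.2)

end CWord

namespace FullyInvCongr

/-- The word `u` has a nontrivial class. -/
def Moves (α : FullyInvCongr) (u : CWord) : Prop := ∃ v, α u v ∧ u ≠ v

section Neutral

variable {α : FullyInvCongr} {u v w : CWord}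

theorem exists_of_modulo {m : ℕ} (hu : u.degree < m) (h : modulo m u w) : ∃ t, w = u + t := by
  obtain ⟨-, p, q, e⟩ := h
  refine exists_add_of_le fun i => ?_
  have h1 : u i + m * p i = w i + m * q i := by simpa using DFunLike.congr_fun e i
  have h2 : u i ≤ u.degree := Finsupp.le_degree i u
  by_contra! h3
  have h4 : p i + 1 ≤ q i := by
    by_contra! h4
    have := Nat.mul_le_mul_left m (Nat.le_of_lt_succ h4)
    omega
  have h5 := Nat.mul_le_mul_left m h4
  rw [mul_add] at h5
  omega

theorem modulo_sup (m : ℕ) (hu : u ≠ 0) (hv : v ≠ 0) :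
    (modulo (m + 1) ⊔ modulo (m + 2)) u v := by
  set w := (m + 2) • u + ((m + 1) * (m + 1)) • v
  have hw : w ≠ 0 := by simp [w, hu]
  refine (modulo (m + 1) ⊔ modulo (m + 2)).trans' (v := w)
    (mono le_sup_left ⟨by tauto, u + (m + 1) • v, 0, ?_⟩)
    (mono le_sup_right ⟨by tauto, 0, u + m • v, ?_⟩)
  · simp only [w]; module
  · simp only [w]; module

theorem not_moves_zero : ¬ Moves α 0 := fun ⟨_, h, hne⟩ => α.ne_zero h hne rfl

theorem Moves.ne_zero (h : Moves α u) : u ≠ 0 := by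
  rintro rfl
  exact not_moves_zero h

theorem Moves.add (h : Moves α u) (w : CWord) : Moves α (u + w) := by
  obtain ⟨v, h, hne⟩ := h
  exact ⟨v + w, α.add_right' w h, by simpa using hne⟩

variable (hα : IsNeutralElt α)
include hα

/-- The nontrivial steps of a neutral congruence can be localized. -/
theorem _root_.IsNeutralElt.exists_step {β γ : FullyInvCongr} (h : α u v)
    (h' : (β ⊔ γ) u v) (hne : u ≠ v) : ∃ w, u ≠ w ∧ α u w ∧ (β u w ∨ γ u w) := by
  have h1 : (α ⊓ (β ⊔ γ)) u v := ⟨h, h'⟩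
  rw [hα.inf_sup] at h1
  obtain ⟨w, hw, h2 | h2⟩ := exists_of_sup h1 hne
  · exact ⟨w, hw, h2.1, .inl h2.2⟩
  · exact ⟨w, hw, h2.1, .inr h2.2⟩

theorem Moves.exists_add (h : Moves α u) :
    ∃ t, t ≠ 0 ∧ (∀ i, t i ≠ 0 → u i ≠ 0) ∧ α u (u + t) := by
  classical
  obtain ⟨v, h, hne⟩ := h
  have hu := α.ne_zero h hne
  obtain ⟨w, hw, h1, h2⟩ := hα.exists_step h
    (modulo_sup u.degree hu (α.ne_zero (α.symm' h) hne.symm)) hne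
  obtain ⟨t, rfl⟩ : ∃ t, w = u + t := h2.elim (exists_of_modulo (by omega))
    (exists_of_modulo (by omega))
  obtain ⟨j, hj⟩ := exists_ne_zero hu
  let θ : ℕ → CWord := fun i => if u i = 0 then letter j else letter i
  have hθ : ∀ i, θ i ≠ 0 := fun i => by
    simp only [θ]
    split_ifs <;> exact letter_ne_zero _
  have h3 := α.subst' hθ h1
  rw [map_add, subst_eq_self (u := u) fun i hi => if_neg hi] at h3
  refine ⟨_, subst_ne_zero hθ (by simpa using hw), fun i hi => ?_, h3⟩
  rw [subst_apply] at hi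
  obtain ⟨k, _, hk⟩ := Finset.exists_ne_zero_of_sum_ne_zero hi
  simp only [θ] at hk
  split_ifs at hk with h4
  · rcases eq_or_ne j i with rfl | h5 <;> simp_all
  · rcases eq_or_ne k i with rfl | h5 <;> simp_all

theorem Moves.subst (h : Moves α u) (θ : ℕ → CWord) (hθ : ∀ i, θ i ≠ 0) :
    Moves α (subst θ u) := by
  obtain ⟨t, ht, -, h1⟩ := h.exists_add hα
  have h2 := α.subst' hθ h1
  rw [map_add] at h2
  exact ⟨_, h2, by simpa using subst_ne_zero hθ ht⟩

/-- A nontrivial class contains a second word of the same degree and content, unless this is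
prevented by avoidance. -/
theorem Moves.exists_same_degree (h : Moves α u) {s : CWord} (hd : s.degree = u.degree)
    (hc : content u s) (hs : ∀ (θ : ℕ → CWord) (r : CWord), (∀ i, θ i ≠ 0) →
      u ≠ CWord.subst θ s + r) :
    ∃ w, u ≠ w ∧ α u w ∧ w.degree = u.degree ∧ content u w := by
  obtain ⟨t, ht, -, h1⟩ := h.exists_add hα
  have hs0 : s ≠ 0 := by
    rintro rfl
    exact h.ne_zero ((Finsupp.degree_eq_zero_iff u).1 (by rw [← hd, map_zero]))
  let J : CWord → Prop := fun w => u.degree < w.degree ∨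
    ∃ (θ : ℕ → CWord) (r : CWord), (∀ i, θ i ≠ 0) ∧ w = CWord.subst θ s + r
  have hJs : J s := .inr ⟨letter, 0, letter_ne_zero, by rw [subst_letter, add_zero]⟩
  have hJu : ¬ J u := by
    rintro (h | ⟨θ, r, hθ, e⟩)
    exacts [lt_irrefl _ h, hs θ r hθ e]
  let γ := rees J
    (by
      rintro (h | ⟨θ, r, hθ, e⟩)
      · simp at h
      · exact subst_ne_zero hθ hs0 (add_eq_zero.1 e.symm).1)
    (by
      rintro w w' (h | ⟨θ, r, hθ, rfl⟩)
      · exact .inl (by rw [map_add]; omega)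
      · exact .inr ⟨θ, r + w', hθ, add_assoc _ _ _⟩)
    (by
      rintro w η hη (h | ⟨θ, r, hθ, rfl⟩)
      · exact .inl (h.trans_le (degree_le_degree_subst hη w))
      · exact .inr ⟨_, CWord.subst η r, fun i => subst_ne_zero hη (hθ i), by
          rw [map_add, subst_subst]⟩)
  have h2 : (layer u.degree ⊔ γ) u (u + t) :=
    (layer u.degree ⊔ γ).trans' (v := s) (mono le_sup_left (.inr (.inr ⟨rfl, hd, hc⟩)))
      (mono le_sup_right (.inr ⟨hJs, .inl (by
        have := degree_pos ht
        rw [map_add]; omega)⟩))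
  obtain ⟨w, hw, h3, h4 | h4⟩ := hα.exists_step h1 h2 (by simpa using ht)
  · rcases h4 with h4 | h4 | h4
    · exact absurd h4 hw
    · exact absurd h4.1 (lt_irrefl _)
    · exact ⟨w, hw, h3, h4.2⟩
  · rcases h4 with h4 | h4
    · exact absurd h4 hw
    · exact absurd h4.1 hJu

end Neutral

end FullyInvCongr

namespace CWord

theorem content_duo {a b c d : ℕ} (ha : a ≠ 0) (hb : b ≠ 0) (hc : c ≠ 0) (hd : d ≠ 0) :
    FullyInvCongr.content (duo a b) (duo c d) := by
  refine FullyInvCongr.content_iff.2 fun i => ?_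
  by_cases h0 : i = 0
  · simp [h0, duo_zero, ha, hc]
  by_cases h1 : i = 1
  · simp [h1, duo_one, hb, hd]
  simp [duo_apply _ _ h0 h1]

theorem exists_eq_duo {a b : ℕ} {w : CWord} (ha : a ≠ 0) (hb : b ≠ 0)
    (h : FullyInvCongr.content (duo a b) w) : ∃ c d, c ≠ 0 ∧ d ≠ 0 ∧ w = duo c d := by
  rw [FullyInvCongr.content_iff] at h
  refine ⟨w 0, w 1, (h 0).1 (by rwa [duo_zero]), (h 1).1 (by rwa [duo_one]),
    eq_duo fun i hi => eq_zero_or_one_of_duo ((h i).2 hi)⟩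

end CWord

namespace FullyInvCongr

section Neutral

variable {α : FullyInvCongr} {u v w : CWord}

theorem duo_subst {a b c d : ℕ} (h : α (duo a b) (duo c d)) {p q : CWord} (hp : p ≠ 0)
    (hq : q ≠ 0) : α (a • p + b • q) (c • p + d • q) := α.subst_pair h hp hq

theorem duo_swap {a b c d : ℕ} (h : α (duo a b) (duo c d)) : α (duo b a) (duo d c) := by
  have := duo_subst h (letter_ne_zero 1) (letter_ne_zero 0)
  rwa [add_comm, add_comm (c • _)] at this

theorem duo_add_right {a b c d : ℕ} (h : α (duo a b) (duo c d)) (p q : ℕ) :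
    α (duo (a + p) (b + q)) (duo (c + p) (d + q)) := by
  simpa only [duo_add] using α.add_right' (duo p q) h

variable (hα : IsNeutralElt α)
include hα

theorem moves_duo_two_one (h : Moves α u) : Moves α (duo 2 1) := by
  obtain ⟨k, hk, h1⟩ : ∃ k, 2 ≤ k ∧ Moves α (duo (k + 1) 1) := by
    have h1 := (h.subst hα (fun _ => letter 0) fun _ => letter_ne_zero 0).add (duo 3 1)
    refine ⟨u.degree + 2, by omega, ?_⟩
    convert h1 using 1
    simp only [subst_const, duo, add_smul]
    abel
  obtain ⟨w, hw, h2, h3, h4⟩ := h1.exists_same_degree hα (s := duo k 2)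
    (by rw [degree_duo, degree_duo])
    (content_duo (by omega) (by omega) (by omega) (by omega)) (fun θ r hθ e => by
      rw [subst_duo] at e
      have h5 := DFunLike.congr_fun e 1
      have h6 := congrArg Finsupp.degree e
      simp only [degree_duo, map_add, map_nsmul, Finsupp.add_apply, Finsupp.smul_apply,
        duo_one, smul_eq_mul] at h5 h6
      have h7 : θ 0 1 = 0 := by
        by_contra h7
        have := Nat.mul_le_mul hk (Nat.one_le_iff_ne_zero.2 h7)
        omega
      rw [h7, mul_zero] at h5
      have h8 := Finsupp.le_degree 1 r
      have h9 := degree_pos (hθ 1)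
      have h10 := Nat.mul_le_mul_left k (degree_pos (hθ 0))
      omega)
  obtain ⟨c, e, hc, he, rfl⟩ := exists_eq_duo (by omega) (by omega) h4
  rw [degree_duo, degree_duo] at h3
  have he2 : 2 ≤ e := by
    by_contra he2
    obtain rfl : e = 1 := by omega
    exact hw (by congr 1; omega)
  have ht : ∀ {a b c d : ℕ}, min a 2 = min c 2 → min b 2 = min d 2 →
      trunc 1 (duo a b) (duo c d) := by
    intro a b c d hac hbd i
    by_cases h0 : i = 0
    · simpa [h0, duo_zero] using hac
    by_cases h1 : i = 1
    · simpa [h1, duo_one] using hbd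
    simp [duo_apply _ _ h0 h1]
  have h5 : (α ⊔ trunc 1) (duo 2 1) (duo 1 2) := by
    set δ := α ⊔ trunc 1
    have hαδ : α ≤ δ := le_sup_left
    have htδ : trunc 1 ≤ δ := le_sup_right
    have h6 : δ (duo 2 1) (duo c e) :=
      δ.trans' (mono htδ (ht (by omega) (by omega))) (mono hαδ h2)
    rcases Nat.lt_or_ge c 2 with hc2 | hc2
    · exact δ.trans' h6 (mono htδ (ht (by omega) (by omega)))
    · exact δ.trans' h6 (δ.trans' (mono htδ (ht (by omega) (by omega)))
        (duo_swap (δ.symm' h6)))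
  have h6 : (α ⊔ layer 3) (duo 2 1) (duo 1 2) := mono le_sup_right
    (.inr (.inr ⟨degree_duo _ _, degree_duo _ _,
      content_duo (by omega) (by omega) (by omega) (by omega)⟩))
  have h7 : (α ⊔ trunc 1 ⊓ layer 3) (duo 2 1) (duo 1 2) := by
    rw [hα.sup_inf]
    exact ⟨h5, h6⟩
  have hne : duo 2 1 ≠ duo 1 2 := fun h => by
    simpa [duo_zero] using DFunLike.congr_fun h 0
  obtain ⟨w, hw, h8 | ⟨h8, h9⟩⟩ := exists_of_sup h7 hne
  · exact ⟨w, h8, hw⟩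
  · rcases h9 with h9 | h9 | ⟨-, h9, h10⟩
    · exact absurd h9 hw
    · rw [degree_duo] at h9
      omega
    · obtain ⟨c, d, hc, hd, rfl⟩ := exists_eq_duo (by omega) (by omega) h10
      have h11 := h8 0
      rw [degree_duo] at h9
      rw [duo_zero, duo_zero] at h11
      obtain ⟨rfl, rfl⟩ : c = 2 ∧ d = 1 := by omega
      exact absurd rfl hw

theorem duo_of_moves (h : Moves α (duo 2 1)) :
    α (duo 2 2) (duo 3 1) ∧ α (duo 2 1) (duo 3 1) := by
  have h1 : Moves α (duo 2 2) := by simpa only [duo_add] using h.add (duo 0 1)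
  have h2 : α (duo 2 2) (duo 3 1) := by
    obtain ⟨w, hw, h2, h3, h4⟩ := h1.exists_same_degree hα (s := duo 3 1)
      (by rw [degree_duo, degree_duo])
      (content_duo (by omega) (by omega) (by omega) (by omega)) (fun θ r hθ e => by
        obtain ⟨i, hi⟩ := exists_ne_zero (hθ 0)
        have h5 := DFunLike.congr_fun e i
        have h6 : duo 2 2 i ≤ 2 := by
          by_cases h0 : i = 0
          · rw [h0, duo_zero]
          by_cases h1 : i = 1
          · rw [h1, duo_one]
          simp [duo_apply _ _ h0 h1]
        rw [subst_duo] at e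
        simp only [subst_duo, Finsupp.add_apply, Finsupp.smul_apply, smul_eq_mul] at h5
        omega)
    obtain ⟨c, d, hc, hd, rfl⟩ := exists_eq_duo (by omega) (by omega) h4
    rw [degree_duo, degree_duo] at h3
    rcases (by omega : c = 3 ∧ d = 1 ∨ c = 2 ∧ d = 2 ∨ c = 1 ∧ d = 3) with
      ⟨rfl, rfl⟩ | ⟨rfl, rfl⟩ | ⟨rfl, rfl⟩
    · exact h2
    · exact absurd rfl hw
    · exact duo_swap h2
  refine ⟨h2, ?_⟩
  have h3 : ∀ j a : ℕ, a ≠ 0 → 3 ≤ a + j → α (duo a (j + 1)) (duo (a + j) 1) := by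
    intro j
    induction j with
    | zero => exact fun _ _ _ => α.refl' _
    | succ j ih =>
      intro a ha haj
      have h4 := ih (a + 1) (by omega) (by omega)
      rw [show a + 1 + j = a + (j + 1) by omega] at h4
      refine α.trans' ?_ h4
      rcases Nat.lt_or_ge a 2 with h5 | h5
      · obtain rfl : a = 1 := by omega
        obtain ⟨b, rfl⟩ := Nat.exists_eq_add_of_le' (show 1 ≤ j by omega)
        have := duo_add_right (duo_swap (α.symm' h2)) 0 b
        rwa [show 3 + b = b + 1 + 1 + 1 by omega, show 2 + b = b + 1 + 1 by omega] at this
      · obtain ⟨b, rfl⟩ := Nat.exists_eq_add_of_le h5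
        have := duo_add_right h2 b j
        rwa [show 3 + b = 2 + b + 1 by omega, show 2 + j = j + 1 + 1 by omega,
          show 1 + j = j + 1 by omega] at this
  have h4 : α (duo 4 1) (duo 5 1) := by
    have h5 : α (duo 2 4) (duo 3 2) := by
      have := duo_subst h2 (letter_ne_zero 0) (q := 2 • letter 1) (by simp)
      rw [smul_smul, smul_smul] at this
      exact this
    exact α.trans' (α.symm' (h3 1 3 (by omega) (by omega)))
      (α.trans' (α.symm' h5) (h3 3 2 (by omega) (by omega)))
  have h5 : ∀ n : ℕ, α (duo 4 1) (duo (4 + n) 1) := fun n => by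
    have h6 : α (duo 4 1) (duo 4 1 + duo 1 0) := by simpa only [duo_add] using h4
    have h7 := α.add_nsmul h6 n
    rwa [smul_duo, duo_add, mul_one, mul_zero] at h7
  obtain ⟨t, ht, hc, h6⟩ := h.exists_add hα
  rw [eq_duo fun i hi => eq_zero_or_one_of_duo (hc i hi)] at h6 ht
  generalize t 0 = p at h6 ht
  generalize t 1 = q at h6 ht
  have hpq : p + q ≠ 0 := by
    rintro h
    obtain ⟨rfl, rfl⟩ : p = 0 ∧ q = 0 := by omega
    simp [duo] at ht
  have h7 := α.add_nsmul h6 2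
  rw [smul_duo, duo_add] at h7
  have h8 : α (duo 2 1) (duo 4 1) := by
    have h9 := h3 (2 * q) (2 + 2 * p) (by omega) (by omega)
    rw [add_comm (2 * q)] at h9
    have h10 := h5 (2 * p + 2 * q - 2)
    rw [show 4 + (2 * p + 2 * q - 2) = 2 + 2 * p + 2 * q by omega] at h10
    exact α.trans' h7 (α.trans' h9 (α.symm' h10))
  have h9 : α (duo 3 1) (duo 5 1) := duo_add_right h8 1 0
  exact α.trans' h8 (α.trans' h4 (α.symm' h9))

/-- Words with the same letters and nontrivial classes are related by a neutral congruence. -/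
theorem Moves.of_content (hu : Moves α u) (hv : Moves α v) (hc : content u v) : α u v := by
  obtain ⟨h22, h21⟩ := duo_of_moves hα (moves_duo_two_one hα hu)
  have habs : ∀ w, Thick w → ∀ j, w j ≠ 0 → α w (w + letter j) := by
    rintro w ⟨i, q, hq, rfl⟩ j hj
    by_cases hqj : q j = 0
    · obtain rfl : i = j := by
        by_contra h
        simp [hqj, h] at hj
      have h1 := duo_subst h21 (letter_ne_zero i) hq
      simp only [one_smul] at h1
      convert h1 using 1
      module
    · obtain ⟨r, rfl⟩ := eq_smul_letter_add (Nat.one_le_iff_ne_zero.2 hqj)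
      have h1 := α.add_right' r
        (duo_subst (α.trans' h21 (α.symm' h22)) (letter_ne_zero i) (letter_ne_zero j))
      convert h1 using 1 <;> module
  have hthick : ∀ {w}, Moves α w → ∃ w', α w w' ∧ Thick w' ∧ content w w' := by
    intro w hw
    obtain ⟨t, ht, htw, h⟩ := hw.exists_add hα
    refine ⟨w + 3 • t, α.add_nsmul h 3, ?_, content_iff.2 fun i => ?_⟩
    · rw [add_comm]
      exact (thick_smul ht le_rfl).add w
    · have := htw i
      simp only [Finsupp.add_apply, Finsupp.smul_apply, smul_eq_mul]
      omega
  obtain ⟨u', hu1, hu2, hu3⟩ := hthick hu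
  obtain ⟨v', hv1, hv2, hv3⟩ := hthick hv
  have hc' := content_iff.1 (content.trans' (content.symm' hu3) (content.trans' hc hv3))
  have h1 := α.absorb (habs u' hu2) (s := v') fun j => (hc' j).2
  have h2 := α.absorb (habs v' hv2) (s := u') fun j => (hc' j).1
  rw [add_comm] at h2
  exact α.trans' hu1 (α.trans' h1 (α.symm' (α.trans' hv1 h2)))

/-- The description of the neutral congruences other than equality. -/
theorem _root_.IsNeutralElt.exists_eq (hne : α ≠ ⊥) :
    ∃ ν : FullyInvCongr, ν (duo 2 1 + letter 2) (duo 2 1) ∧ (α = ν ∨ α = content ⊓ ν) := by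
  have hex : ∃ u, Moves α u := by
    by_contra! hno
    refine hne (le_antisymm (fun u v h => ?_) bot_le)
    by_contra huv
    exact hno u ⟨v, h, huv⟩
  obtain ⟨u₀, hu₀⟩ := hex
  have h21 := moves_duo_two_one hα hu₀
  let ν := rees (Moves α) not_moves_zero (fun _ w h => h.add w)
    (fun _ θ hθ h => h.subst hα θ hθ)
  have hαν : α ≤ ν := fun u v h => by
    rcases eq_or_ne u v with rfl | huv
    · exact .inl rfl
    · exact .inr ⟨⟨v, h, huv⟩, ⟨u, α.symm' h, huv.symm⟩⟩
  refine ⟨ν, .inr ⟨h21.add _, h21⟩, ?_⟩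
  by_cases hσ : α ≤ content
  · refine .inr (le_antisymm (le_inf hσ hαν) ?_)
    rintro u v ⟨hc, rfl | ⟨hu, hv⟩⟩
    exacts [α.refl' u, hu.of_content hα hv hc]
  · refine .inl (le_antisymm hαν ?_)
    rintro u v (rfl | ⟨hu, hv⟩)
    · exact α.refl' u
    obtain ⟨a, b, hb, hab⟩ := exists_absorb_of_not_le_content hσ hσ
    have key : ∀ {u v}, Moves α u → v ≠ 0 → ∃ t, (∀ i, t i ≠ 0 → u i ≠ 0) ∧
        α u (u + t + b • v) := by
      intro u v hu hv
      obtain ⟨t, ht, htu, h⟩ := hu.exists_add hα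
      refine ⟨a • t, fun i hi => htu i fun h0 => hi (by simp [h0]),
        α.trans' (α.add_nsmul h a) ?_⟩
      rw [add_assoc]
      exact α.add_left u (hab t v ht hv).1
    obtain ⟨s, hs, h1⟩ := key hu hv.ne_zero
    obtain ⟨t, ht, h2⟩ := key hv hu.ne_zero
    refine α.trans' h1 (α.trans' ?_ (α.symm' h2))
    refine ((hu.add _).add _).of_content hα ((hv.add _).add _) (content_iff.2 fun i => ?_)
    have := hs i
    have := ht i
    simp only [Finsupp.add_apply, Finsupp.smul_apply, smul_eq_mul, ne_eq,
      Nat.add_eq_zero_iff, mul_eq_zero]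
    tauto

end Neutral

theorem isNeutralElt_bot : IsNeutralElt (⊥ : FullyInvCongr) := fun β γ => by simp

theorem isNeutralElt_of_duo {ν : FullyInvCongr} (h : ν (duo 2 1 + letter 2) (duo 2 1)) :
    IsNeutralElt ν := by
  let J : CWord → Prop := fun u => u ≠ 0 ∧ ∀ r, ν u (u + r)
  have hthick : ∀ u, Thick u → J u := by
    rintro u ⟨i, q, hq, rfl⟩
    refine ⟨by simp [hq], fun r => ?_⟩
    rcases eq_or_ne r 0 with rfl | hr
    · simpa using ν.refl' _
    have h1 := ν.subst' (θ := fun j => if j = 0 then letter i else if j = 1 then q else r)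
      (fun j => by
        split_ifs
        exacts [letter_ne_zero i, hq, hr]) h
    rw [map_add, subst_duo] at h1
    simpa using ν.symm' h1
  have hν : ν = rees J (fun h => h.1 rfl)
      (fun u w hu => ⟨by simp [hu.1], fun r => by
        have h1 := hu.2 (w + r)
        rw [← add_assoc] at h1
        exact ν.trans' (ν.symm' (hu.2 w)) h1⟩)
      (fun u θ hθ hu => ⟨subst_ne_zero hθ hu.1, fun r => by
        rcases eq_or_ne r 0 with rfl | hr
        · simpa using ν.refl' _
        obtain ⟨j, hj⟩ := Infinite.exists_notMem_finset u.support
        rw [Finsupp.notMem_support_iff] at hj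
        have h1 := ν.subst' (θ := Function.update θ j r) (fun i => by
          rcases eq_or_ne i j with rfl | h
          · simpa using hr
          · simpa [h] using hθ i) (hu.2 (letter j))
        have h2 : CWord.subst (Function.update θ j r) u = CWord.subst θ u := by
          refine subst_congr fun i hi => Function.update_of_ne ?_ _ _
          rintro rfl
          exact hi hj
        rw [map_add, h2] at h1
        simpa using h1⟩) := by
    refine le_antisymm (fun u v huv => ?_) ?_
    · rcases eq_or_ne u v with rfl | hne
      · exact .inl rfl
      have key : ∀ {u v}, ν u v → u ≠ v → J u := by
        intro u v huv hne
        by_cases hu : Thick u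
        · exact hthick u hu
        obtain ⟨c, hc, h1⟩ := ν.exists_add_smul_self hu huv hne
        have hu0 := ν.ne_zero huv hne
        have h2 := ν.add_nsmul h1 2
        have h3 : Thick (u + 2 • c • u) := by
          rw [smul_smul, ← succ_nsmul']
          exact thick_smul hu0 (by omega)
        exact ⟨hu0, fun r => ν.trans' h2 (ν.trans' ((hthick _ h3).2 r)
          (ν.symm' (ν.add_right' r h2)))⟩
      exact .inr ⟨key huv hne, key (ν.symm' huv) hne.symm⟩
    · rintro u v (rfl | ⟨hu, hv⟩)
      · exact ν.refl' u
      · refine ν.trans' (hu.2 v) ?_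
        rw [add_comm]
        exact ν.symm' (hv.2 u)
  rw [hν]
  exact isNeutralElt_rees hthick

/-- The neutral elements of the lattice of fully invariant congruences. -/
theorem isNeutralElt_iff {α : FullyInvCongr} : IsNeutralElt α ↔
    α = ⊥ ∨ ∃ ν : FullyInvCongr, ν (duo 2 1 + letter 2) (duo 2 1) ∧
      (α = ν ∨ α = content ⊓ ν) := by
  refine ⟨fun h => or_iff_not_imp_left.2 h.exists_eq, ?_⟩
  rintro (rfl | ⟨ν, h, rfl | rfl⟩)
  exacts [isNeutralElt_bot, isNeutralElt_of_duo h,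
    isNeutralElt_content.inf (isNeutralElt_of_duo h)]

end FullyInvCongr

/-! ### Varieties and fully invariant congruences -/

/-- The multiplicities of the letters of a semigroup word. -/
noncomputable def cnt (a : SGWord) : CWord :=
  (FreeSemigroup.lift fun i => Multiplicative.ofAdd (letter i) : SGWord →ₙ* _) a |>.toAdd

theorem cnt_mul (a b : SGWord) : cnt (a * b) = cnt a + cnt b := by
  simp [cnt]

theorem cnt_ltr (i : ℕ) : cnt (ltr i) = letter i := by
  simp [cnt, ltr]

theorem lift_ltr {S : Type} [Semigroup S] (f : ℕ → S) (i : ℕ) :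
    FreeSemigroup.lift f (ltr i) = f i := by
  simp [ltr]

theorem SGWord.induction {P : SGWord → Prop} (h1 : ∀ i, P (ltr i))
    (h2 : ∀ a b, P a → P b → P (a * b)) (a : SGWord) : P a :=
  FreeSemigroup.recOnMul a h1 fun _ _ => h2 _ _

theorem cnt_ne_zero (a : SGWord) : cnt a ≠ 0 := by
  induction a using SGWord.induction with
  | h1 i => simp [cnt_ltr]
  | h2 a b ha hb => simp [cnt_mul, ha]

theorem exists_cnt {u : CWord} (hu : u ≠ 0) : ∃ a, cnt a = u := by
  induction u using Finsupp.induction_linear with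
  | zero => exact absurd rfl hu
  | add f g hf hg =>
    rcases eq_or_ne f 0 with rfl | hf'
    · rw [zero_add] at hu ⊢
      exact hg hu
    rcases eq_or_ne g 0 with rfl | hg'
    · rw [add_zero]
      exact hf hf'
    obtain ⟨a, rfl⟩ := hf hf'
    obtain ⟨b, rfl⟩ := hg hg'
    exact ⟨a * b, cnt_mul a b⟩
  | single i n =>
    have hn : n ≠ 0 := by simpa using hu
    clear hu
    induction n with
    | zero => exact absurd rfl hn
    | succ n ih =>
      rcases eq_or_ne n 0 with rfl | hn'
      · exact ⟨ltr i, cnt_ltr i⟩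
      · obtain ⟨a, ha⟩ := ih hn'
        exact ⟨a * ltr i, by rw [cnt_mul, ha, cnt_ltr, ← Finsupp.single_add]⟩

theorem coe_lift_eq {S : Type} [CommSemigroup S] (f : ℕ → S) (a : SGWord) :
    (FreeSemigroup.lift f a : WithOne S) = (cnt a).prod fun i n => (f i : WithOne S) ^ n := by
  induction a using SGWord.induction with
  | h1 i => simp [cnt_ltr, lift_ltr]
  | h2 a b ha hb =>
    rw [map_mul, WithOne.coe_mul, ha, hb, cnt_mul, Finsupp.prod_add_index']
    · simp
    · simp [pow_add]

theorem lift_eq_of_cnt_eq {S : Type} [CommSemigroup S] (f : ℕ → S) {a b : SGWord}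
    (h : cnt a = cnt b) : FreeSemigroup.lift f a = FreeSemigroup.lift f b :=
  WithOne.coe_injective (by rw [coe_lift_eq, coe_lift_eq, h])

theorem lift_lift {S : Type} [Semigroup S] (f : ℕ → S) (τ : ℕ → SGWord) (a : SGWord) :
    FreeSemigroup.lift f (FreeSemigroup.lift τ a) =
      FreeSemigroup.lift (fun i => FreeSemigroup.lift f (τ i)) a := by
  induction a using SGWord.induction with
  | h1 i => simp only [lift_ltr]
  | h2 a b ha hb => simp only [map_mul, ha, hb]

theorem cnt_lift (τ : ℕ → SGWord) (a : SGWord) :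
    cnt (FreeSemigroup.lift τ a) = subst (fun i => cnt (τ i)) (cnt a) := by
  induction a using SGWord.induction with
  | h1 i => simp [lift_ltr, cnt_ltr]
  | h2 a b ha hb => rw [map_mul, cnt_mul, ha, hb, cnt_mul, map_add]

namespace ComVariety

variable (V : ComVariety)

theorem mem_theory {V : ComVariety} {i : SGId} :
    i ∈ V.theory ↔ ∀ S ∈ modelsOf V.theory, SGSatisfies S.carrier i := by
  conv_lhs => rw [← V.closed]
  rfl

theorem mem_of_cnt_eq {a b : SGWord} (h : cnt a = cnt b) : (a, b) ∈ V.theory :=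
  mem_theory.2 fun _ _ f => lift_eq_of_cnt_eq f h

theorem symm_mem {a b : SGWord} (h : (a, b) ∈ V.theory) : (b, a) ∈ V.theory :=
  mem_theory.2 fun S hS f => (mem_theory.1 h S hS f).symm

theorem trans_mem {a b c : SGWord} (h : (a, b) ∈ V.theory) (h' : (b, c) ∈ V.theory) :
    (a, c) ∈ V.theory :=
  mem_theory.2 fun S hS f => (mem_theory.1 h S hS f).trans (mem_theory.1 h' S hS f)

theorem mul_right_mem {a b : SGWord} (h : (a, b) ∈ V.theory) (c : SGWord) :
    (a * c, b * c) ∈ V.theory :=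
  mem_theory.2 fun S hS f => by
    have h1 : FreeSemigroup.lift f a = FreeSemigroup.lift f b := mem_theory.1 h S hS f
    simp only [map_mul, h1]

theorem lift_mem {a b : SGWord} (h : (a, b) ∈ V.theory) (τ : ℕ → SGWord) :
    (FreeSemigroup.lift τ a, FreeSemigroup.lift τ b) ∈ V.theory :=
  mem_theory.2 fun S hS f => by
    simp only [lift_lift]
    exact mem_theory.1 h S hS _

theorem mem_congr {a b a' b' : SGWord} (ha : cnt a = cnt a') (hb : cnt b = cnt b')
    (h : (a, b) ∈ V.theory) : (a', b') ∈ V.theory :=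
  V.trans_mem (V.mem_of_cnt_eq ha.symm) (V.trans_mem h (V.mem_of_cnt_eq hb))

/-- The fully invariant congruence formed by the identities of a variety. -/
def congr : FullyInvCongr where
  rel u v := (u = 0 ↔ v = 0) ∧ ∀ a b, cnt a = u → cnt b = v → (a, b) ∈ V.theory
  refl' _ := ⟨Iff.rfl, fun _ _ ha hb => V.mem_of_cnt_eq (ha.trans hb.symm)⟩
  symm' := fun ⟨h, h'⟩ => ⟨h.symm, fun _ _ ha hb => V.symm_mem (h' _ _ hb ha)⟩
  trans' := by
    rintro u v w ⟨h, h'⟩ ⟨k, k'⟩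
    refine ⟨h.trans k, fun a b ha hb => ?_⟩
    obtain ⟨c, hc⟩ := exists_cnt (u := v) (fun hv => cnt_ne_zero a (ha.trans (h.2 hv)))
    exact V.trans_mem (h' a c ha hc) (k' c b hc hb)
  add_right' := by
    rintro u v w ⟨h, h'⟩
    refine ⟨(⊤ : FullyInvCongr).add_right' w h, fun a b ha hb => ?_⟩
    by_cases hu : u = 0
    · rw [h.1 hu] at hb
      rw [hu] at ha
      exact V.mem_of_cnt_eq (ha.trans hb.symm)
    obtain ⟨a', rfl⟩ := exists_cnt hu
    obtain ⟨b', rfl⟩ := exists_cnt (mt h.2 hu)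
    have h1 := h' a' b' rfl rfl
    by_cases hw : w = 0
    · rw [hw, add_zero] at ha hb
      exact V.mem_congr ha.symm hb.symm h1
    obtain ⟨c, rfl⟩ := exists_cnt hw
    rw [← cnt_mul] at ha hb
    exact V.mem_congr ha.symm hb.symm (V.mul_right_mem h1 c)
  subst' := by
    rintro u v θ hθ ⟨h, h'⟩
    refine ⟨(⊤ : FullyInvCongr).subst' hθ h, fun a b ha hb => ?_⟩
    choose τ hτ using fun i => exists_cnt (hθ i)
    by_cases hu : u = 0
    · rw [h.1 hu] at hb
      rw [hu] at ha
      exact V.mem_of_cnt_eq (ha.trans hb.symm)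
    obtain ⟨a', rfl⟩ := exists_cnt hu
    obtain ⟨b', rfl⟩ := exists_cnt (mt h.2 hu)
    obtain rfl : (fun i => cnt (τ i)) = θ := funext hτ
    rw [← cnt_lift] at ha hb
    exact V.mem_congr ha.symm hb.symm (V.lift_mem (h' a' b' rfl rfl) τ)
  eq_zero' h := h.1.1 rfl

theorem congr_cnt {V : ComVariety} {a b : SGWord} :
    V.congr (cnt a) (cnt b) ↔ (a, b) ∈ V.theory :=
  ⟨fun h => h.2 a b rfl rfl, fun h => ⟨by simp [cnt_ne_zero], fun _ _ ha hb =>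
    V.mem_congr ha.symm hb.symm h⟩⟩

theorem le_comVar {V : ComVariety} {E : Set SGId} : V ≤ comVar E ↔ E ⊆ V.theory :=
  ⟨fun h => (subset_theoryOfClass_modelsOf E).trans h, fun h => by
    have := theoryOfClass_antitone (modelsOf_antitone h)
    rwa [V.closed] at this⟩

end ComVariety

namespace FullyInvCongr

variable (β : FullyInvCongr)

/-- The congruence of the free semigroup induced by a fully invariant congruence. -/
def toCon : Con SGWord where
  r a b := β (cnt a) (cnt b)
  iseqv := ⟨fun _ => β.refl' _, β.symm', β.trans'⟩
  mul' h h' := by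
    rw [cnt_mul, cnt_mul]
    exact β.add h h'

/-- The relatively free commutative semigroup of a fully invariant congruence. -/
def free : ComSG where
  carrier := β.toCon.Quotient
  str :=
    { (inferInstance : Semigroup β.toCon.Quotient) with
      mul_comm := by
        rintro ⟨a⟩ ⟨b⟩
        refine (Con.eq β.toCon).2 ?_
        change β (cnt (a * b)) (cnt (b * a))
        rw [cnt_mul, cnt_mul, add_comm]
        exact β.refl' _ }
  instNonempty := ⟨(ltr 0 : β.toCon.Quotient)⟩

/-- The value of a word at the free generators. -/
def eval (a : SGWord) : β.free.carrier := (a : β.toCon.Quotient)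

theorem eval_mul (a b : SGWord) : β.eval (a * b) = β.eval a * β.eval b := rfl

theorem eval_eq_iff {a b : SGWord} : β.eval a = β.eval b ↔ β (cnt a) (cnt b) :=
  Con.eq β.toCon

theorem exists_eval (x : β.free.carrier) : ∃ a, β.eval a = x := Quotient.exists_rep x

theorem lift_eval (τ : ℕ → SGWord) (a : SGWord) :
    FreeSemigroup.lift (fun i => β.eval (τ i)) a = β.eval (FreeSemigroup.lift τ a) := by
  induction a using SGWord.induction with
  | h1 i => simp only [lift_ltr]
  | h2 a b ha hb => rw [map_mul, ha, hb, map_mul, eval_mul]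

/-- The variety defined by a fully invariant congruence. -/
def variety : ComVariety where
  theory := {i | β (cnt i.1) (cnt i.2)}
  closed := by
    refine subset_antisymm ?_ (subset_theoryOfClass_modelsOf _)
    rintro ⟨a, b⟩ h
    have hfree : β.free ∈ modelsOf {i : SGId | β (cnt i.1) (cnt i.2)} := by
      intro i hi f
      choose τ hτ using fun i => β.exists_eval (f i)
      obtain rfl : (fun i => β.eval (τ i)) = f := funext hτ
      rw [lift_eval, lift_eval, eval_eq_iff, cnt_lift, cnt_lift]
      exact β.subst' (fun i => cnt_ne_zero _) hi
    have h1 := h β.free hfree fun i => β.eval (ltr i)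
    rw [lift_eval, lift_eval, eval_eq_iff, cnt_lift, cnt_lift] at h1
    simpa only [cnt_ltr, subst_letter, Set.mem_ofPred_eq] using h1

end FullyInvCongr

/-- The lattice of varieties is dual to the lattice of fully invariant congruences. -/
noncomputable def ComVariety.orderIso : ComVariety ≃o FullyInvCongrᵒᵈ where
  toFun V := OrderDual.toDual V.congr
  invFun β := (OrderDual.ofDual β).variety
  left_inv V := ComVariety.ext' (Set.ext fun _ => ComVariety.congr_cnt)
  right_inv β := by
    refine congrArg OrderDual.toDual (FullyInvCongr.ext ?_)
    ext u v
    refine ⟨fun ⟨h, h'⟩ => ?_, fun h => ⟨FullyInvCongr.mono le_top h, ?_⟩⟩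
    · by_cases hu : u = 0
      · rw [hu, h.1 hu]
        exact FullyInvCongr.refl' _ _
      obtain ⟨a, rfl⟩ := exists_cnt hu
      obtain ⟨b, rfl⟩ := exists_cnt (mt h.2 hu)
      exact h' a b rfl rfl
    · rintro a b rfl rfl
      exact h
  map_rel_iff' {V W} := by
    refine ⟨fun h i hi => ?_, fun h u v huv => ?_⟩
    · exact ComVariety.congr_cnt.1 (FullyInvCongr.mono h (ComVariety.congr_cnt.2 hi))
    · exact ⟨huv.1, fun a b ha hb => h (huv.2 a b ha hb)⟩

theorem isNeutralElt_orderIso {α β : Type*} [Lattice α] [Lattice β] (e : α ≃o β) {x : α} :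
    IsNeutralElt (e x) ↔ IsNeutralElt x := by
  refine ⟨fun h y z => e.injective ?_, fun h y z => ?_⟩
  · simpa only [map_sup, map_inf] using h (e y) (e z)
  · simpa only [map_sup, map_inf, OrderIso.apply_symm_apply] using
      congrArg e (h (e.symm y) (e.symm z))

namespace ComVariety

variable {V W : ComVariety}

theorem isNeutralElt_congr : IsNeutralElt V.congr ↔ IsNeutralElt V :=
  isNeutralElt_toDual.symm.trans (isNeutralElt_orderIso orderIso)

theorem congr_injective : Function.Injective congr :=
  fun _ _ h => orderIso.injective (congrArg OrderDual.toDual h)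

theorem congr_variety (β : FullyInvCongr) : β.variety.congr = β :=
  congrArg OrderDual.ofDual (orderIso.apply_symm_apply (OrderDual.toDual β))

theorem congr_sup : (V ⊔ W).congr = V.congr ⊓ W.congr :=
  congrArg OrderDual.ofDual (map_sup orderIso V W)

theorem congr_COMvar : COMvar.congr = ⊥ := by
  have h : COMvar = ⊤ := top_le_iff.1 (le_comVar.2 (Set.singleton_subset_iff.2
    (mem_of_cnt_eq _ (by rw [cnt_mul, cnt_mul, add_comm]))))
  rw [h]
  exact congrArg OrderDual.ofDual (map_top orderIso)

theorem mem_comVar {E : Set SGId} {i : SGId} (h : i ∈ E) :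
    (comVar E).congr (cnt i.1) (cnt i.2) :=
  congr_cnt.2 (le_comVar.1 le_rfl h)

theorem congr_Tvar : Tvar.congr = ⊤ := by
  refine top_le_iff.1 fun u v h => ?_
  by_cases hu : u = 0
  · rw [hu, h.1 hu]
    exact FullyInvCongr.refl' _ _
  have h1 : Tvar.congr (cnt (ltr 0)) (cnt (ltr 1)) := mem_comVar (Set.mem_singleton _)
  have h2 := Tvar.congr.subst' (θ := fun i => if i = 0 then u else v)
    (fun i => by split_ifs; exacts [hu, mt h.2 hu]) h1
  simpa [cnt_ltr] using h2

theorem congr_SLvar : SLvar.congr = FullyInvCongr.content := by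
  have e : cnt (wpow (ltr 0) 2) = letter 0 + letter 0 := by
    rw [← cnt_ltr, ← cnt_mul]
    rfl
  refine le_antisymm ?_ fun u v h => ?_
  · have h1 : FullyInvCongr.content.variety ≤ SLvar := le_comVar.2 (by
      rintro i (rfl | rfl)
      · refine FullyInvCongr.content_iff.2 fun i => ?_
        simp only [e, cnt_ltr, Finsupp.add_apply]
        omega
      · change FullyInvCongr.content _ _
        simp only [commId, cnt_mul, add_comm]
        exact FullyInvCongr.refl' _ _)
    rw [← congr_variety FullyInvCongr.content]
    exact orderIso.le_iff_le.2 h1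
  · have h1 : SLvar.congr (letter 0 + letter 0) (letter 0) := by
      rw [← e, ← cnt_ltr]
      exact mem_comVar (Set.mem_insert _ _)
    have h2 : ∀ w : CWord, ∀ j, w j ≠ 0 → SLvar.congr w (w + letter j) := by
      intro w j hj
      obtain ⟨q, rfl⟩ := eq_smul_letter_add (Nat.one_le_iff_ne_zero.2 hj)
      have h3 := SLvar.congr.subst' (fun _ => letter_ne_zero j) h1
      have h4 := SLvar.congr.add_right' q (SLvar.congr.symm' h3)
      convert h4 using 1
      · simp
      · simp only [map_add, subst_const, Finsupp.degree_single]
        module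
    rw [FullyInvCongr.content_iff] at h
    have h3 := SLvar.congr.absorb (h2 u) (s := v) fun j => (h j).2
    have h4 := SLvar.congr.absorb (h2 v) (s := u) fun j => (h j).1
    rw [add_comm] at h4
    exact SLvar.congr.trans' h3 (SLvar.congr.symm' h4)

theorem zeroId_subset : zeroId (wpow (ltr 0) 2 * ltr 1) 2 ⊆ V.theory ↔
    V.congr (duo 2 1 + letter 2) (duo 2 1) := by
  have e : cnt (wpow (ltr 0) 2 * ltr 1) = duo 2 1 := by
    have h : wpow (ltr 0) 2 = ltr 0 * ltr 0 := rfl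
    rw [h, cnt_mul, cnt_mul, cnt_ltr, cnt_ltr, duo]
    module
  rw [← e, ← cnt_ltr, ← cnt_mul, congr_cnt, zeroId, Set.insert_subset_iff,
    Set.singleton_subset_iff, and_iff_left_iff_imp]
  exact V.mem_congr (by rw [cnt_mul, add_comm, ← cnt_mul]) rfl

end ComVariety

/-- **Theorem.** A commutative semigroup variety `V` is a neutral element of the lattice
**Com** if and only if either `V = COM`, or `V = M ∨ N` where `M` is one of the
varieties `T` or `SL` and the variety `N` satisfies the identity `x²y = 0`. -/
theorem neutral_elements_of_Com (V : ComVariety) :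
    IsNeutralElt V ↔
      V = COMvar ∨
      ∃ M N : ComVariety, (M = Tvar ∨ M = SLvar) ∧
        zeroId (wpow (ltr 0) 2 * ltr 1) 2 ⊆ N.theory ∧ V = M ⊔ N := by
  rw [← ComVariety.isNeutralElt_congr, FullyInvCongr.isNeutralElt_iff]
  refine or_congr ?_ ⟨?_, ?_⟩
  · rw [← ComVariety.congr_COMvar, ComVariety.congr_injective.eq_iff]
  · rintro ⟨ν, h, h'⟩
    have hN : zeroId (wpow (ltr 0) 2 * ltr 1) 2 ⊆ ν.variety.theory := by
      rwa [ComVariety.zeroId_subset, ComVariety.congr_variety]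
    rcases h' with h' | h'
    · refine ⟨Tvar, ν.variety, .inl rfl, hN, ComVariety.congr_injective ?_⟩
      rw [ComVariety.congr_sup, ComVariety.congr_Tvar, ComVariety.congr_variety, top_inf_eq, h']
    · refine ⟨SLvar, ν.variety, .inr rfl, hN, ComVariety.congr_injective ?_⟩
      rw [ComVariety.congr_sup, ComVariety.congr_SLvar, ComVariety.congr_variety, h']
  · rintro ⟨M, N, hM, hN, rfl⟩
    refine ⟨N.congr, ComVariety.zeroId_subset.1 hN, ?_⟩
    rw [ComVariety.congr_sup]
    rcases hM with rfl | rfl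
    · rw [ComVariety.congr_Tvar, top_inf_eq]
      exact .inl rfl
    · rw [ComVariety.congr_SLvar]
      exact .inr rfl
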